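/- Let ℓ be a prime of the form ℓ = 4k + 1 where k = 1 or k is prime, and let p ≠ ℓ be a prime with p ≡ 1 (mod 4). Then there exists n ≥ 1 such that H_ℓ is maximal over 𝔽_{p^{2n}} if and only if p is a primitive root modulo ℓ (the class of p generates (ℤ/ℓℤ)^×). -/

import Mathlib

open Polynomial

/-- Number of affine points (x,y) ∈ F × F with y² = φ_d(x), where φ_d is the
d-th Chebyshev (Dickson first kind, parameter 1) polynomial over F. -/
noncomputable def chebAffineCount (F : Type) [Field F] (d : ℕ) : ℕ :=
  Nat.card {xy : F × F // xy.2 ^ 2 = (dickson 1 (1 : F) d).eval xy.1}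

/-- The hyperelliptic curve H_d : y² = φ_d(x) is maximal over the field with q² elements:
its affine point count attains q² + (d-1)q (Hasse–Weil bound minus the point at infinity). -/
def chebMaximal (d q : ℕ) : Prop :=
  ∀ (F : Type) [Field F] [Fintype F], Fintype.card F = q ^ 2 →
    chebAffineCount F d = q ^ 2 + (d - 1) * q


namespace Cheb

set_option linter.unusedSectionVars false

section Stick

variable {F : Type} [Field F] [Fintype F] (p : ℕ) [hp : Fact p.Prime] [CharP F p]

/-- inverse of the Teichmüller character, with values in Witt vectors -/
noncomputable def th : MulChar F (WittVector p F) where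
  toFun x := WittVector.teichmuller p x⁻¹
  map_one' := by simp
  map_mul' x y := by rw [mul_inv, map_mul]
  map_nonunit' x hx := by
    have : x = 0 := by simpa using hx
    simp [this, WittVector.teichmuller_zero]

lemma th_apply (x : F) : th p x = WittVector.teichmuller p x⁻¹ := rfl

lemma cc_th (x : F) : WittVector.constantCoeff (th p x) = x⁻¹ := by
  rw [th_apply]; simp [WittVector.constantCoeff, WittVector.teichmuller_coeff_zero]

lemma th_inj : Function.Injective (th (F := F) p) := by
  intro x y h
  have := congrArg WittVector.constantCoeff h
  rw [cc_th, cc_th] at this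
  exact inv_injective this

lemma th_pow_card (N : ℕ) (hN : Fintype.card F = N + 1) : (th (F := F) p) ^ N = 1 := by
  ext x
  rw [MulChar.pow_apply_coe, MulChar.one_apply_coe, ← map_pow, ← Units.val_pow_eq_pow_val]
  have : x ^ N = 1 := by
    have h := FiniteField.pow_card_sub_one_eq_one (x : F) x.ne_zero
    rw [hN, Nat.add_sub_cancel] at h
    exact Units.ext (by simpa using h)
  rw [this]; simp

lemma th_pow_ne_one {N : ℕ} (hN : Fintype.card F = N + 1) {m : ℕ} (hm : ¬ N ∣ m) :
    (th (F := F) p) ^ m ≠ 1 := by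
  intro h
  apply hm
  have := (FiniteField.forall_pow_eq_one_iff F m).1 ?_
  · rw [hN] at this; simpa using this
  · intro x
    have h1 := congrArg (fun c : MulChar F (WittVector p F) => c x) h
    simp only [MulChar.pow_apply_coe, MulChar.one_apply_coe, ← map_pow] at h1
    rw [← map_one (th (F := F) p)] at h1
    have := th_inj p h1
    exact Units.ext (by simpa using this)

lemma th_pow_mod {N : ℕ} (hN : Fintype.card F = N + 1) (m : ℕ) :
    (th (F := F) p) ^ m = (th (F := F) p) ^ (m % N) := by
  conv_lhs => rw [← Nat.div_add_mod m N, pow_add, pow_mul, th_pow_card p N hN, one_pow, one_mul]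

instance charZeroW : CharZero (WittVector p F) := by
  obtain ⟨r, hr⟩ := CharP.exists (WittVector p F)
  rcases CharP.char_is_prime_or_zero (WittVector p F) r with h | h
  · exfalso
    have h0 : ((r : ℕ) : WittVector p F) = 0 := CharP.cast_eq_zero _ r
    have h1 := congrArg WittVector.constantCoeff h0
    rw [map_natCast, map_zero, CharP.cast_eq_zero_iff F p] at h1
    have := (Nat.prime_dvd_prime_iff_eq hp.out h).1 h1
    subst this
    exact WittVector.p_nonzero p F h0
  · subst h
    exact CharP.charP_to_charZero _

lemma exists_embed : ∃ ι : WittVector p F →+* ℂ, Function.Injective ι := by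
  let A := AlgebraicClosure (FractionRing (WittVector p F))
  have : CharZero (FractionRing (WittVector p F)) := charZero_of_injective_algebraMap (IsFractionRing.injective (WittVector p F) _)
  have hW : Cardinal.mk (WittVector p F) = Cardinal.continuum := by
    have e : WittVector p F ≃ (ℕ → F) := ⟨fun x => x.coeff, fun x => ⟨x⟩, fun x => rfl, fun x => rfl⟩
    rw [Cardinal.mk_congr e]
    simp only [Cardinal.mk_pi, Cardinal.prod_const, Cardinal.lift_id, Cardinal.mk_fintype, Cardinal.mk_nat]
    exact Cardinal.nat_power_aleph0 (Fintype.one_lt_card)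
  have hK : Cardinal.mk (FractionRing (WittVector p F)) = Cardinal.continuum := by
    rw [← hW]
    have : Infinite (WittVector p F) := by
      rw [Cardinal.infinite_iff, hW]; exact Cardinal.aleph0_le_continuum
    exact IsFractionRing.cardinalMk (WittVector p F) _
  have hA : Cardinal.mk A = Cardinal.continuum := by
    apply le_antisymm
    · refine (Algebra.IsAlgebraic.cardinalMk_le_max (FractionRing (WittVector p F)) A).trans ?_
      rw [hK]; exact max_le le_rfl Cardinal.aleph0_le_continuum
    · rw [← hK]
      exact Cardinal.mk_le_of_injective (algebraMap (FractionRing (WittVector p F)) A).injective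
  have : CharZero A := algebraRat.charZero A
  obtain ⟨e⟩ := IsAlgClosed.ringEquiv_of_equiv_of_charZero (K := A) (L := ℂ)
    (by rw [hA]; exact Cardinal.aleph0_lt_continuum)
    (Cardinal.eq.1 (by rw [hA, Cardinal.mk_complex]))
  refine ⟨(e : A →+* ℂ).comp ((algebraMap (FractionRing (WittVector p F)) A).comp
    (algebraMap (WittVector p F) (FractionRing (WittVector p F)))), ?_⟩
  exact e.injective.comp ((algebraMap (FractionRing (WittVector p F)) A).injective.comp
    (IsFractionRing.injective _ _))

end Stick
end Cheb

namespace Cheb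

set_option linter.unusedSectionVars false
set_option linter.unusedVariables false

section Stick2

variable {F : Type} [Field F] [Fintype F] (p : ℕ) [hp : Fact p.Prime] [CharP F p]

lemma sum_T {N : ℕ} (hN : Fintype.card F = N + 1) (j : ℕ) (hj : j ≤ N) (hN1 : 1 < N) :
    ∑ y : F, (1 - y) ^ j * y⁻¹ = j := by
  induction j with
  | zero =>
    have h := FiniteField.sum_pow_lt_card_sub_one F 1 (by rw [hN]; simpa using hN1)
    simp only [pow_zero, one_mul, Nat.cast_zero]
    rw [← h]
    simp only [pow_one]
    exact Fintype.sum_equiv (Equiv.inv F) _ _ (fun x => rfl)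
  | succ j ih =>
    have ih := ih (by omega)
    classical
    have h1 : ∀ y : F, (1 - y) ^ (j + 1) * y⁻¹ =
        (1 - y) ^ j * y⁻¹ - (1 - y) ^ j + (if y = 0 then 1 else 0) := by
      intro y
      by_cases hy : y = 0
      · simp [hy]
      · simp only [hy, if_false]; field_simp; ring
    have h2 : ∑ y : F, (1 - y) ^ j = 0 := by
      rw [← FiniteField.sum_pow_lt_card_sub_one F j (by rw [hN]; simp; omega)]
      exact Fintype.sum_equiv (Equiv.subLeft 1) _ _ (fun x => rfl)
    rw [Finset.sum_congr rfl (fun y _ => h1 y), Finset.sum_add_distrib, Finset.sum_sub_distrib,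
      ih, h2]
    simp

lemma inv_pow_eq {N : ℕ} (hN : Fintype.card F = N + 1) (z : F) (m : ℕ) (hm : 0 < m) (hmN : m < N) :
    (z⁻¹) ^ m = z ^ (N - m) := by
  by_cases hz : z = 0
  · rw [hz, inv_zero, zero_pow (by omega), zero_pow (by omega)]
  · have h := FiniteField.pow_card_sub_one_eq_one z hz
    rw [hN, Nat.add_sub_cancel] at h
    rw [inv_pow]
    apply inv_eq_of_mul_eq_one_left
    rw [← pow_add, ← h]; congr 1; omega

lemma unit_J {N : ℕ} (hN : Fintype.card F = N + 1) (m : ℕ) (hm : 0 < m) (hmN : m + 1 < N)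
    (hpm : ¬ p ∣ m + 1) : IsUnit (jacobiSum ((th (F := F) p) ^ m) (th p)) := by
  apply WittVector.isUnit_of_coeff_zero_ne_zero
  have h0 : (jacobiSum ((th (F := F) p) ^ m) (th p)).coeff 0 =
      WittVector.constantCoeff (jacobiSum ((th (F := F) p) ^ m) (th p)) := rfl
  rw [h0, jacobiSum, map_sum]
  have h1 : ∀ x : F, WittVector.constantCoeff (((th (F := F) p) ^ m) x * (th p) (1 - x)) =
      x ^ (N - m) * (1 - x)⁻¹ := by
    intro x
    rw [map_mul, MulChar.pow_apply' _ (by omega), map_pow, cc_th, cc_th, inv_pow_eq hN _ _ hm (by omega)]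
  rw [Finset.sum_congr rfl (fun x _ => h1 x)]
  have h2 : ∑ x : F, x ^ (N - m) * (1 - x)⁻¹ = ∑ y : F, (1 - y) ^ (N - m) * y⁻¹ :=
    Fintype.sum_equiv (Equiv.subLeft 1) _ _ (fun x => by simp)
  rw [h2, sum_T hN _ (by omega) (by omega)]
  have h3 : ((N + 1 : ℕ) : F) = 0 := by rw [← hN]; exact FiniteField.cast_card_eq_zero F
  intro h4
  have h5 : ((m + 1 : ℕ) : F) = 0 := by
    have : ((N + 1 : ℕ) : F) = ((N - m : ℕ) : F) + ((m + 1 : ℕ) : F) := by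
      rw [← Nat.cast_add]; congr 1; omega
    rw [h3, h4, zero_add] at this
    exact this.symm
  exact hpm ((CharP.cast_eq_zero_iff F p _).1 h5)

variable (ι : WittVector p F →+* ℂ) (hι : Function.Injective ι) (ψ : AddChar F ℂ)

noncomputable def g (m : ℕ) : ℂ := gaussSum (((th (F := F) p) ^ m).ringHomComp ι) ψ

lemma mulShift_surj (hψ : ψ ≠ 1) (ψ' : AddChar F ℂ) : ∃ c, ψ' = AddChar.mulShift ψ c := by
  have h1 : Function.Injective (AddChar.mulShift ψ) :=
    AddChar.to_mulShift_inj_of_isPrimitive (AddChar.IsPrimitive.of_ne_one hψ)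
  have h2 : Function.Bijective (AddChar.mulShift ψ) :=
    (Fintype.bijective_iff_injective_and_card _).2 ⟨h1, (AddChar.card_eq).symm⟩
  obtain ⟨c, hc⟩ := h2.2 ψ'
  exact ⟨c, hc.symm⟩

lemma g_frob (hψ : ψ ≠ 1) (m : ℕ) : ∃ u : (WittVector p F)ˣ, g p ι ψ (p * m) = ι u * g p ι ψ m := by
  let e : F ≃+* F := frobeniusEquiv F p
  let ψ' : AddChar F ℂ := ψ.compAddMonoidHom (e.symm.toAddEquiv : F →+ F)
  have hψ' : ψ' ≠ 1 := by
    intro h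
    apply hψ
    ext x
    have := congrArg (fun c : AddChar F ℂ => c (e x)) h
    simpa [ψ'] using this
  obtain ⟨c, hc⟩ := mulShift_surj ψ hψ ψ'
  have hc0 : c ≠ 0 := by
    rintro rfl
    exact hψ' (by rw [hc, AddChar.mulShift_zero])
  obtain ⟨u, hu⟩ : IsUnit ((th (F := F) p ^ m)⁻¹ c) := (IsUnit.mk0 c hc0).map _
  refine ⟨u, ?_⟩
  have h1 := gaussSum_mulShift_eq (((th (F := F) p) ^ m).ringHomComp ι) ψ (Units.mk0 c hc0)
  rw [MulChar.ringHomComp_inv, MulChar.ringHomComp_apply, Units.val_mk0, ← hc, ← hu] at h1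
  rw [g, g, ← h1, gaussSum, gaussSum]
  refine Fintype.sum_equiv e.toEquiv _ _ (fun x => ?_)
  have h2 : (th (F := F) p ^ (p * m)) x = (th (F := F) p ^ m) (e x) := by
    rw [mul_comm, pow_mul, MulChar.pow_apply' _ hp.out.ne_zero, ← map_pow]
    rfl
  rw [MulChar.ringHomComp_apply, MulChar.ringHomComp_apply, h2]
  congr 1
  simp [ψ']

lemma g_succ {N : ℕ} (hN : Fintype.card F = N + 1) (m : ℕ) (hm : 0 < m) (hmN : m + 1 < N)
    (hpm : ¬ p ∣ m + 1) (hι : Function.Injective ι) :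
    ∃ u : (WittVector p F)ˣ, g p ι ψ (m + 1) = ι u * (g p ι ψ m * g p ι ψ 1) := by
  obtain ⟨v, hv⟩ := unit_J p hN m hm hmN hpm
  refine ⟨v⁻¹, ?_⟩
  have h1 : ((th (F := F) p) ^ m).ringHomComp ι * ((th (F := F) p) ^ 1).ringHomComp ι =
      ((th (F := F) p) ^ (m + 1)).ringHomComp ι := by
    rw [← MulChar.ringHomComp_mul, ← pow_add]
  have h2 := jacobiSum_mul_nontrivial (χ := ((th (F := F) p) ^ m).ringHomComp ι)
    (φ := ((th (F := F) p) ^ 1).ringHomComp ι) (by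
      rw [h1, MulChar.ringHomComp_ne_one_iff hι]
      exact th_pow_ne_one p hN (fun h => by have := Nat.le_of_dvd (by omega) h; omega)) ψ
  rw [h1, jacobiSum_ringHomComp, pow_one, ← hv] at h2
  have h3 : ι ((v⁻¹ : (WittVector p F)ˣ) : WittVector p F) * ι v = 1 := by
    rw [← map_mul]; simp
  rw [g, g, g, pow_one, ← h2]
  linear_combination (-gaussSum ((th (F := F) p ^ (m + 1)).ringHomComp ι) ψ) * h3

/-- the sum of the residues `p ^ i * m mod N` -/
def Dd (f N m : ℕ) : ℕ := ∑ i ∈ Finset.range f, (p ^ i * m) % N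

lemma Dd_frob (f N m : ℕ) (hN : p ^ f = N + 1) : Dd p f N (p * m) = Dd p f N m := by
  have h := Finset.sum_range_succ' (fun i => (p ^ i * m) % N) f
  rw [Finset.sum_range_succ] at h
  have h2 : (p ^ f * m) % N = (p ^ 0 * m) % N := by
    rw [hN, add_mul, pow_zero]; simp
  rw [h2] at h
  have h3 := Nat.add_right_cancel h
  rw [Dd, Dd, h3]
  refine Finset.sum_congr rfl (fun i _ => ?_)
  rw [pow_succ, mul_assoc]

lemma Dd_succ (f N m : ℕ) (hN : p ^ f = N + 1) (hmN : m + 1 < N) (hpm : ¬ p ∣ m + 1) :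
    Dd p f N (m + 1) = Dd p f N m + Dd p f N 1 := by
  rw [Dd, Dd, Dd, ← Finset.sum_add_distrib]
  refine Finset.sum_congr rfl (fun i hi => ?_)
  rw [Finset.mem_range] at hi
  have hppos := hp.out.pos
  have hpi : p ^ i * p ^ (f - i) = N + 1 := by rw [← pow_add, ← hN]; congr 1; omega
  have hp2 : p ∣ p ^ (f - i) := dvd_pow_self p (by omega)
  have hpp : 0 < p ^ i := by positivity
  have h2p : 2 ≤ p ^ (f - i) := le_trans hp.out.two_le (Nat.le_of_dvd (by positivity) hp2)
  have hlt : p ^ i < N := by nlinarith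
  rw [mul_one, mul_add, mul_one, Nat.add_mod, Nat.mod_eq_of_lt hlt]
  apply Nat.mod_eq_of_lt
  by_contra hcon
  push Not at hcon
  set y := p ^ i * m % N with hy
  have hyN : y < N := Nat.mod_lt _ (by omega)
  obtain ⟨j, hj⟩ : ∃ j, y + j = N := ⟨N - y, by omega⟩
  have hj1 : 1 ≤ j := by omega
  have hjp : j ≤ p ^ i := by omega
  -- multiply by p ^ (f - i)
  have h1 : (p ^ (f - i) * y) % N = m := by
    rw [hy, Nat.mul_mod, Nat.mod_mod, ← Nat.mul_mod, ← mul_assoc, mul_comm (p ^ (f - i)), hpi, add_mul]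
    simp; exact Nat.mod_eq_of_lt (by omega)
  have h2 : N ∣ m + j * p ^ (f - i) := by
    have h3 : p ^ (f - i) * y + j * p ^ (f - i) = p ^ (f - i) * N := by rw [← hj]; ring
    have h4 : (m + j * p ^ (f - i)) % N = 0 := by
      conv_lhs => rw [← h1, Nat.add_mod, Nat.mod_mod, ← Nat.add_mod, h3]
      simp
    exact Nat.dvd_of_mod_eq_zero h4
  obtain ⟨c, hc⟩ := h2
  have h5 : j * p ^ (f - i) ≤ N + 1 := by rw [← hpi]; exact Nat.mul_le_mul_right _ hjp
  have h6 : 0 < j * p ^ (f - i) := by positivity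
  have hc1 : c = 1 := by
    have : c < 2 := by
      by_contra h; push Not at h
      nlinarith
    have : c ≠ 0 := by rintro rfl; omega
    omega
  subst hc1
  apply hpm
  have h7 : m + 1 + j * p ^ (f - i) = p ^ i * p ^ (f - i) := by omega
  have h8 : p ∣ m + 1 + j * p ^ (f - i) := by rw [h7]; exact Dvd.dvd.mul_left hp2 _
  exact (Nat.dvd_add_left (Dvd.dvd.mul_left hp2 _)).1 h8

lemma g_zero (hψ : ψ ≠ 1) : g p ι ψ 0 = -1 := by
  rw [g, pow_zero, MulChar.ringHomComp_one, gaussSum_one_left hψ]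

lemma g_main {f N : ℕ} (hN : Fintype.card F = N + 1) (hf : p ^ f = N + 1) (hN1 : 1 < N)
    (hι : Function.Injective ι) (hψ : ψ ≠ 1) (m : ℕ) :
    m < N → ∃ (d : ℕ) (u : (WittVector p F)ˣ), g p ι ψ m = ι u * g p ι ψ 1 ^ d ∧
      Dd p f N m = d * Dd p f N 1 := by
  induction m using Nat.strong_induction_on with
  | _ m ih =>
  intro hm
  rcases Nat.eq_zero_or_pos m with rfl | hm0
  · exact ⟨0, -1, by rw [g_zero p ι ψ hψ]; simp, by simp [Dd]⟩
  by_cases hpm : p ∣ m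
  · obtain ⟨m', rfl⟩ := hpm
    have hm' : 0 < m' := Nat.pos_of_mul_pos_left hm0
    have hlt : m' < p * m' := by nlinarith [hp.out.two_le]
    obtain ⟨d, u, h1, h2⟩ := ih m' hlt (by omega)
    obtain ⟨v, hv⟩ := g_frob p ι ψ hψ m'
    refine ⟨d, v * u, ?_, ?_⟩
    · rw [hv, h1]; push_cast; rw [map_mul]; ring
    · rw [Dd_frob p f N m' hf, h2]
  · obtain ⟨m', rfl⟩ : ∃ m', m = m' + 1 := ⟨m - 1, by omega⟩
    rcases Nat.eq_zero_or_pos m' with rfl | hm'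
    · exact ⟨1, 1, by simp, by simp⟩
    obtain ⟨d, u, h1, h2⟩ := ih m' (by omega) (by omega)
    obtain ⟨v, hv⟩ := g_succ p ι ψ hN m' hm' hm hpm hι
    refine ⟨d + 1, v * u, ?_, ?_⟩
    · rw [hv, h1]; push_cast; rw [map_mul]; ring
    · rw [Dd_succ p f N m' hf hm hpm, h2]; ring

end Stick2
end Cheb

namespace Cheb

set_option linter.unusedSectionVars false
set_option linter.unusedVariables false

section Stick3

variable {F : Type} [Field F] [Fintype F] (p : ℕ) [hp : Fact p.Prime] [CharP F p]

lemma Dd_one {f N : ℕ} (hf : p ^ f = N + 1) (hN1 : 1 < N) : Dd p f N 1 * (p - 1) = N := by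
  have h1 : Dd p f N 1 = ∑ i ∈ Finset.range f, p ^ i := by
    refine Finset.sum_congr rfl (fun i hi => ?_)
    rw [Finset.mem_range] at hi
    rw [mul_one]
    apply Nat.mod_eq_of_lt
    have : p ^ (i+1) ≤ N + 1 := by rw [← hf]; exact Nat.pow_le_pow_right hp.out.pos hi
    have h2 := hp.out.two_le
    have h3 : 0 < p ^ i := by positivity
    rw [pow_succ] at this
    nlinarith
  rw [h1, Nat.geomSum_eq hp.out.two_le, hf, Nat.add_sub_cancel]
  apply Nat.div_mul_cancel
  have := Nat.sub_one_dvd_pow_sub_one p f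
  rwa [hf, Nat.add_sub_cancel] at this

lemma Dd_neg {f N : ℕ} (hf : p ^ f = N + 1) (hN1 : 1 < N) :
    Dd p f N (N - 1) + Dd p f N 1 = f * N := by
  rw [Dd, Dd, ← Finset.sum_add_distrib, Finset.sum_congr rfl (g := fun _ => N)]
  · simp
  intro i hi
  rw [Finset.mem_range] at hi
  have : p ^ (i+1) ≤ N + 1 := by rw [← hf]; exact Nat.pow_le_pow_right hp.out.pos hi
  have h2 := hp.out.two_le
  have h3 : 0 < p ^ i := by positivity
  rw [pow_succ] at this
  have hlt : p ^ i < N := by nlinarith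
  rw [mul_one, Nat.mod_eq_of_lt hlt]
  have : p ^ i * (N - 1) = (N - p ^ i) + N * (p ^ i - 1) := by
    zify [hlt.le, (by omega : 1 ≤ N), (by omega : 1 ≤ p ^ i)]; ring
  rw [this, Nat.add_mul_mod_self_left, Nat.mod_eq_of_lt (by omega)]
  omega

lemma exists_psi : ∃ ψ : AddChar F ℂ, ψ ≠ 1 := by
  obtain ⟨ψ, hψ⟩ := AddChar.exists_apply_ne_zero.2 (one_ne_zero (α := F))
  exact ⟨ψ, fun h => hψ (by rw [h]; rfl)⟩

lemma g_refl {f N : ℕ} (hN : Fintype.card F = N + 1) (hf : p ^ f = N + 1) (hN1 : 1 < N)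
    (ι : WittVector p F →+* ℂ) (ψ : AddChar F ℂ)
    (hι : Function.Injective ι) (hψ : ψ ≠ 1) : ∃ u : (WittVector p F)ˣ,
    g p ι ψ 1 ^ (f * (p - 1)) = ι (u * (p : WittVector p F) ^ f) := by
  obtain ⟨d, u, h1, h2⟩ := g_main p ι ψ hN hf hN1 hι hψ (N - 1) (by omega)
  have h3 := Dd_neg p hf hN1
  have h4 := Dd_one p hf hN1
  have hD : 0 < Dd p f N 1 := by
    rcases Nat.eq_zero_or_pos (Dd p f N 1) with h | h
    · rw [h] at h4; omega
    · exact h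
  have hd : d + 1 = f * (p - 1) := by
    apply Nat.eq_of_mul_eq_mul_right hD
    rw [add_mul, one_mul, ← h2, h3, mul_assoc, mul_comm (p - 1), h4]
  have h5 : (th (F := F) p) ^ (N - 1) = (th p)⁻¹ := by
    apply eq_inv_of_mul_eq_one_left
    rw [← pow_succ, Nat.sub_add_cancel (by omega), th_pow_card p N hN]
  have hne : (th (F := F) p).ringHomComp ι ≠ 1 := by
    rw [MulChar.ringHomComp_ne_one_iff hι]
    have := th_pow_ne_one (F := F) p hN (m := 1) (fun h => by have := Nat.le_of_dvd (by omega) h; omega)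
    simpa using this
  have h6 := gaussSum_mul_gaussSum_eq_card hne (AddChar.IsPrimitive.of_ne_one hψ)
  have h7 := mul_gaussSum_inv_eq_gaussSum ((th (F := F) p).ringHomComp ι)⁻¹ ψ
  obtain ⟨v, hv⟩ : IsUnit ((th (F := F) p)⁻¹ (-1)) := (IsUnit.neg isUnit_one).map _
  have h8 : g p ι ψ 1 * g p ι ψ (N - 1) = ι (v * (p : WittVector p F) ^ f) := by
    rw [g, g, h5, pow_one, ← MulChar.ringHomComp_inv, ← h7, MulChar.ringHomComp_inv,
      MulChar.ringHomComp_apply, ← hv, map_mul]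
    rw [← MulChar.ringHomComp_inv, mul_left_comm, h6, hN, ← hf]; simp
  refine ⟨u⁻¹ * v, ?_⟩
  rw [← hd, pow_succ]
  rw [h1] at h8
  have h9 : ι ((u⁻¹ : (WittVector p F)ˣ) : WittVector p F) * ι u = 1 := by
    rw [← map_mul]; simp
  push_cast
  rw [mul_assoc, map_mul, ← h8]
  linear_combination (-g p ι ψ 1 ^ (d + 1)) * h9

lemma jac_val {f N : ℕ} (hN : Fintype.card F = N + 1) (hf : p ^ f = N + 1) (hN1 : 1 < N)
    (m1 m2 r : ℕ) (hm1 : m1 < N) (hm2 : m2 < N) (hm : ¬ N ∣ m1 + m2)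
    (hr : Dd p f N m1 + Dd p f N m2 = Dd p f N ((m1 + m2) % N) + N * r) :
    ∃ u : (WittVector p F)ˣ, jacobiSum ((th (F := F) p) ^ m1) (th p ^ m2) ^ f =
      u * (p : WittVector p F) ^ (f * r) := by
  obtain ⟨ι, hι⟩ := exists_embed (F := F) p
  obtain ⟨ψ, hψ⟩ := exists_psi (F := F)
  obtain ⟨u, hu⟩ := g_refl p hN hf hN1 ι ψ hι hψ
  obtain ⟨d1, u1, a1, b1⟩ := g_main p ι ψ hN hf hN1 hι hψ m1 hm1
  obtain ⟨d2, u2, a2, b2⟩ := g_main p ι ψ hN hf hN1 hι hψ m2 hm2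
  obtain ⟨d3, u3, a3, b3⟩ := g_main p ι ψ hN hf hN1 hι hψ ((m1 + m2) % N) (Nat.mod_lt _ (by omega))
  have h4 := Dd_one p hf hN1
  have hD : 0 < Dd p f N 1 := by
    rcases Nat.eq_zero_or_pos (Dd p f N 1) with h | h
    · rw [h] at h4; omega
    · exact h
  have hd : d1 + d2 = d3 + r * (p - 1) := by
    apply Nat.eq_of_mul_eq_mul_right hD
    rw [add_mul, add_mul, ← b1, ← b2, ← b3, hr, mul_assoc, mul_comm (p - 1), h4, mul_comm N]
  have e1 : ((th (F := F) p) ^ m1).ringHomComp ι * ((th (F := F) p) ^ m2).ringHomComp ι =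
      ((th (F := F) p) ^ ((m1 + m2) % N)).ringHomComp ι := by
    rw [← MulChar.ringHomComp_mul, ← pow_add, th_pow_mod p hN (m1 + m2)]
  have e2 := jacobiSum_mul_nontrivial (χ := ((th (F := F) p) ^ m1).ringHomComp ι)
    (φ := ((th (F := F) p) ^ m2).ringHomComp ι) (by
      rw [e1, ← th_pow_mod p hN, MulChar.ringHomComp_ne_one_iff hι]
      exact th_pow_ne_one p hN hm) ψ
  rw [e1, jacobiSum_ringHomComp] at e2
  change g p ι ψ _ * _ = g p ι ψ _ * g p ι ψ _ at e2
  rw [a1, a2, a3] at e2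
  set J := jacobiSum ((th (F := F) p) ^ m1) (th p ^ m2)
  set G := g p ι ψ 1
  have hG : G ≠ 0 := by
    intro h
    have hfp : 0 < f := by
      rcases Nat.eq_zero_or_pos f with h | h
      · rw [h] at hf; simp at hf; omega
      · exact h
    have := hp.out.two_le
    rw [h, zero_pow (by apply Nat.mul_ne_zero <;> omega)] at hu
    have h0 := hι (hu.symm.trans (map_zero ι).symm)
    have := (Units.mul_right_eq_zero u).1 h0
    exact WittVector.p_nonzero p F (pow_eq_zero_iff (by omega) |>.1 this)
  have h5 : ι (u3 * J) = ι (u1 * u2) * G ^ (r * (p - 1)) := by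
    apply mul_left_cancel₀ (pow_ne_zero d3 hG)
    rw [map_mul, map_mul]
    have h6 : G ^ d1 * G ^ d2 = G ^ d3 * G ^ (r * (p - 1)) := by rw [← pow_add, ← pow_add, hd]
    linear_combination e2 + ι u1 * ι u2 * h6
  have h6 : (u3 * J) ^ f = (u1 * u2) ^ f * (u * (p : WittVector p F) ^ f) ^ r := by
    apply hι
    rw [map_pow, h5, mul_pow, ← pow_mul, map_mul ι (_ ^ f), map_pow, map_pow ι _ r, ← hu, ← pow_mul]
    congr 2; ring
  refine ⟨(u3⁻¹) ^ f * (u1 * u2) ^ f * u ^ r, ?_⟩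
  push_cast
  rw [mul_assoc, mul_assoc, pow_mul, ← mul_pow, ← h6, mul_pow, ← mul_assoc, ← mul_pow]
  simp

/-- the half-range indicator count -/
lemma Dd_half {f N h m : ℕ} (hNh : N = 2 * h) (hp2 : p % 2 = 1) :
    Dd p f N m + Dd p f N h = Dd p f N ((m + h) % N) +
      N * ((Finset.range f).filter (fun i => h ≤ (p ^ i * m) % N)).card := by
  rw [Finset.card_filter, Finset.mul_sum, Dd, Dd, Dd, ← Finset.sum_add_distrib,
    ← Finset.sum_add_distrib]
  refine Finset.sum_congr rfl (fun i _ => ?_)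
  rcases Nat.eq_zero_or_pos h with h0 | hpos
  · subst h0; subst hNh; simp
  have hodd : (p ^ i) % 2 = 1 := by rw [Nat.pow_mod, hp2]; simp
  have h1 : (p ^ i * h) % N = h := by
    obtain ⟨c, hc⟩ : ∃ c, p ^ i = 2 * c + 1 := ⟨p ^ i / 2, by omega⟩
    have : p ^ i * h = h + N * c := by rw [hc, hNh]; ring
    rw [this, Nat.add_mul_mod_self_left, Nat.mod_eq_of_lt (by omega)]
  have h2 : (p ^ i * ((m + h) % N)) % N = ((p ^ i * m) % N + h) % N := by
    rw [Nat.mul_mod, Nat.mod_mod, ← Nat.mul_mod, mul_add, Nat.add_mod, h1]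
  rw [h1, h2]
  have h3 : (p ^ i * m) % N < N := Nat.mod_lt _ (by omega)
  set y := (p ^ i * m) % N
  split_ifs with hy
  · have : (y + h) = (y + h - N) + N := by omega
    rw [this, Nat.add_mod_right, Nat.mod_eq_of_lt (by omega)]; omega
  · rw [Nat.mod_eq_of_lt (by omega)]; omega

end Stick3
end Cheb

namespace Cheb

set_option linter.unusedSectionVars false
set_option linter.unusedVariables false

section JacA

variable {F : Type} [Field F] [Fintype F] [DecidableEq F] (p : ℕ) [hp : Fact p.Prime] [CharP F p]

noncomputable def chiW : MulChar F (WittVector p F) :=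
  (quadraticChar F).ringHomComp (Int.castRingHom _)

lemma chiW_apply (x : F) : chiW p x = ((quadraticChar F x : ℤ) : WittVector p F) := rfl

lemma th_neg_one (h2 : ringChar F ≠ 2) : th (F := F) p (-1) = -1 := by
  have h1 : th (F := F) p (-1) * th (F := F) p (-1) = 1 := by
    rw [← map_mul]; simp
  rcases mul_self_eq_one_iff.1 h1 with h | h
  · rw [← map_one (th (F := F) p)] at h
    exact absurd (th_inj p h) (Ring.neg_one_ne_one_of_char_ne_two h2)
  · exact h

lemma th_half {N h : ℕ} (hN : Fintype.card F = N + 1) (hNh : N = 2 * h) (h2 : ringChar F ≠ 2) :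
    (th (F := F) p) ^ h = chiW p := by
  ext x
  have hc : Fintype.card F / 2 = h := by omega
  rw [MulChar.pow_apply_coe, ← map_pow, ← hc, ← quadraticChar_eq_pow_of_char_ne_two' h2, chiW_apply]
  rcases quadraticChar_dichotomy x.ne_zero with h | h
  · rw [h]; simp
  · rw [h]; push_cast; rw [th_neg_one p h2]

/-- the Jacobi sums occurring in the point count -/
noncomputable def JJ (M a : ℕ) : WittVector p F := jacobiSum ((th (F := F) p) ^ (a * M)) (chiW p)

/-- counting function for valuations -/
def rr (f d a : ℕ) : ℕ := ((Finset.range f).filter (fun i => 2 * d ≤ (p ^ i * a) % (4 * d))).card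

lemma JJ_val {f d M a : ℕ} (hN : Fintype.card F = 4 * d * M + 1) (hf : p ^ f = 4 * d * M + 1)
    (hM : 0 < M) (hd : 0 < d) (ha : a < 4 * d) (hodd : a % 2 = 1) (h2 : ringChar F ≠ 2)
    (hp2 : p % 2 = 1) :
    ∃ u : (WittVector p F)ˣ, JJ (F := F) p M a ^ f = u * (p : WittVector p F) ^ (f * rr p f d a) := by
  have hdM : 0 < d * M := Nat.mul_pos hd hM
  have hr := Dd_half p (f := f) (N := 4 * d * M) (h := 2 * d * M) (m := a * M) (by ring) hp2
  have hlt : a * M < 4 * d * M := Nat.mul_lt_mul_of_pos_right ha hM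
  have := jac_val (F := F) p hN hf (by nlinarith) (a * M) (2 * d * M) _ hlt
    (by nlinarith) (by
      intro h
      have : 4 * d * M ∣ (a + 2 * d) * M := by rwa [add_mul]
      have := Nat.dvd_of_mul_dvd_mul_right hM this
      obtain ⟨c, hc⟩ := this
      have : a + 2 * d = 2 * (2 * d * c) := by rw [hc]; ring
      omega) hr
  rw [th_half p (N := 4 * d * M) (h := 2 * d * M) hN (by ring) h2] at this
  obtain ⟨u, hu⟩ := this
  refine ⟨u, ?_⟩
  rw [JJ, hu, rr]
  congr 4
  refine Finset.filter_congr (fun i _ => ?_)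
  rw [← mul_assoc, Nat.mul_mod_mul_right]
  exact ⟨fun h => Nat.le_of_mul_le_mul_right h hM, fun h => Nat.mul_le_mul_right M h⟩

lemma primeW : Prime (p : WittVector p F) := (WittVector.irreducible p).prime

lemma JJ_dvd {f n r : ℕ} (J : WittVector p F) (hf : 0 < f)
    (h : ∃ u : (WittVector p F)ˣ, J ^ f = u * (p : WittVector p F) ^ (f * r)) (hn : n ≤ r) :
    (p : WittVector p F) ^ n ∣ J := by
  obtain ⟨u, hu⟩ := h
  rw [← IsIntegrallyClosed.pow_dvd_pow_iff (n := f) (by omega), hu, ← pow_mul]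
  exact Dvd.dvd.mul_left (pow_dvd_pow _ (by rw [mul_comm]; exact Nat.mul_le_mul_left _ hn)) _

lemma JJ_eq {f n r : ℕ} (J : WittVector p F) (hf : 0 < f)
    (h : ∃ u : (WittVector p F)ˣ, J ^ f = u * (p : WittVector p F) ^ (f * r))
    (hJ : J = (p : WittVector p F) ^ n) : r = n := by
  obtain ⟨u, hu⟩ := h
  rw [hJ, ← pow_mul] at hu
  have hpr := primeW (F := F) p
  have h1 : (p : WittVector p F) ^ (n * f) ∣ (p : WittVector p F) ^ (f * r) := by
    rw [hu]; exact Units.mul_left_dvd.2 dvd_rfl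
  have h2 : (p : WittVector p F) ^ (f * r) ∣ (p : WittVector p F) ^ (n * f) := by
    rw [hu]; exact Dvd.intro_left _ rfl
  rw [pow_dvd_pow_iff hpr.ne_zero hpr.not_isUnit] at h1 h2
  have : f * r = f * n := by rw [mul_comm f n]; omega
  exact Nat.eq_of_mul_eq_mul_left hf this

lemma intW_dvd {n : ℕ} {z : ℤ} (h : (p : WittVector p F) ^ n ∣ (z : WittVector p F)) :
    (p : ℤ) ^ n ∣ z := by
  induction n generalizing z with
  | zero => simp
  | succ n ih =>
    have hpz : (p : ℤ) ∣ z := by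
      obtain ⟨c, hc⟩ := (dvd_pow_self _ (by omega)).trans h
      have := congrArg WittVector.constantCoeff hc
      rw [map_mul, map_natCast, map_intCast, CharP.cast_eq_zero, zero_mul] at this
      exact (CharP.intCast_eq_zero_iff F p z).1 this
    obtain ⟨w, rfl⟩ := hpz
    rw [pow_succ']
    apply mul_dvd_mul_left
    apply ih
    push_cast at h
    rw [pow_succ'] at h
    exact (mul_dvd_mul_iff_left (primeW (F := F) p).ne_zero).1 h

end JacA
end Cheb

namespace Cheb

set_option linter.unusedSectionVars false
set_option linter.unusedVariables false

section BSum

variable {F : Type} [Field F] [Fintype F] [DecidableEq F]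

/-- the sum `∑ χ(t) χ(1 - t^(2d))` -/
noncomputable def BB (F : Type) [Field F] [Fintype F] [DecidableEq F] (d : ℕ) : ℤ :=
  ∑ t : F, quadraticChar F t * quadraticChar F (1 - t ^ (2 * d))

noncomputable def cf (d : ℕ) (x : F) : ℤ :=
  ∑ t : F, if t ^ (2 * d) = x then quadraticChar F t else 0

lemma BB_cf (d : ℕ) : BB F d = ∑ x : F, cf d x * quadraticChar F (1 - x) := by
  simp only [BB, cf, Finset.sum_mul]
  rw [Finset.sum_comm]
  refine Finset.sum_congr rfl (fun t _ => ?_)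
  simp

lemma exists_gen {N : ℕ} (hN : Fintype.card F = N + 1) :
    ∃ γ : Fˣ, (∀ x : F, x ≠ 0 → ∃ i : ℕ, x = (γ : F) ^ i) ∧ orderOf γ = N := by
  obtain ⟨γ, hγ⟩ := IsCyclic.exists_generator (α := Fˣ)
  refine ⟨γ, ?_, ?_⟩
  · intro x hx
    obtain ⟨i, hi⟩ := (mem_powers_iff_mem_zpowers.2 (hγ (Units.mk0 x hx)))
    refine ⟨i, ?_⟩
    have := congrArg (fun u : Fˣ => (u : F)) hi
    simpa using this.symm
  · rw [orderOf_eq_card_of_forall_mem_zpowers hγ, Nat.card_eq_fintype_card, Fintype.card_units, hN]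
    simp

lemma card_roots_one {d M : ℕ} (hN : Fintype.card F = 4 * d * M + 1) (hd : 0 < d) (hM : 0 < M) :
    (Finset.univ.filter (fun t : F => t ^ (2 * d) = 1)).card = 2 * d := by
  obtain ⟨γ, h1, h2⟩ := exists_gen hN
  have h3 : IsPrimitiveRoot γ (2 * M * (2 * d)) := by
    rw [IsPrimitiveRoot.iff_orderOf, h2]; ring
  have h4 : IsPrimitiveRoot (γ ^ (2 * M)) (2 * d) := h3.pow (by positivity) rfl
  have h5 : IsPrimitiveRoot ((γ ^ (2 * M) : Fˣ) : F) (2 * d) := h4.map_of_injective (f := Units.coeHom F) Units.val_injective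
  refine Eq.trans ?_ h5.card_nthRootsFinset
  congr 1
  ext t
  simp [mem_nthRootsFinset (by omega : 0 < 2 * d)]

lemma pow_of_pow {d M : ℕ} (hN : Fintype.card F = 4 * d * M + 1) (hd : 0 < d) (hM : 0 < M)
    (x : F) (hx0 : x ≠ 0) (hx : x ^ (2 * M) = 1) : ∃ t : F, t ≠ 0 ∧ t ^ (2 * d) = x := by
  obtain ⟨γ, h1, h2⟩ := exists_gen hN
  obtain ⟨i, rfl⟩ := h1 x hx0
  rw [← pow_mul] at hx
  have h3 : γ ^ (i * (2 * M)) = 1 := Units.ext (by simpa using hx)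
  have h4 := orderOf_dvd_of_pow_eq_one h3
  rw [h2] at h4
  have : 2 * d ∣ i := by
    apply Nat.dvd_of_mul_dvd_mul_right (by positivity : 0 < 2 * M)
    convert h4 using 1; ring
  obtain ⟨j, rfl⟩ := this
  exact ⟨(γ : F) ^ j, pow_ne_zero _ γ.ne_zero, by rw [← pow_mul, mul_comm]⟩

lemma chi_root {d M : ℕ} (hN : Fintype.card F = 4 * d * M + 1) (hd : 0 < d) (hM : 0 < M)
    (h2 : ringChar F ≠ 2) (t : F) (ht : t ^ (2 * d) = 1) : quadraticChar F t = 1 := by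
  have ht0 : t ≠ 0 := by rintro rfl; rw [zero_pow (by omega)] at ht; exact zero_ne_one ht
  rw [quadraticChar_one_iff_isSquare ht0, FiniteField.isSquare_iff h2 ht0]
  have : Fintype.card F / 2 = 2 * d * M := by rw [hN, mul_assoc 4, mul_assoc 2]; omega
  rw [this, pow_mul, ht, one_pow]

lemma cf_cases {d M : ℕ} (hN : Fintype.card F = 4 * d * M + 1) (hd : 0 < d) (hM : 0 < M)
    (h2 : ringChar F ≠ 2) (x : F) :
    (∃ t0 : F, t0 ≠ 0 ∧ t0 ^ (2 * d) = x ∧ cf d x = 2 * d * quadraticChar F t0) ∨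
    ((∀ t : F, t ≠ 0 → t ^ (2 * d) ≠ x) ∧ cf d x = 0) := by
  by_cases h : ∃ t0 : F, t0 ≠ 0 ∧ t0 ^ (2 * d) = x
  · left
    obtain ⟨t0, h0, rfl⟩ := h
    refine ⟨t0, h0, rfl, ?_⟩
    rw [cf, ← Fintype.sum_equiv (Equiv.mulLeft₀ t0 h0)
      (fun s => if s ^ (2 * d) = 1 then quadraticChar F t0 else 0) _ ?_]
    · rw [← Finset.sum_filter, Finset.sum_const, card_roots_one hN hd hM]
      push_cast; simp
    · intro s
      simp only [Equiv.mulLeft₀_apply, mul_pow, mul_eq_left₀ (pow_ne_zero (2 * d) h0), map_mul]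
      split_ifs with hs
      · rw [chi_root hN hd hM h2 s hs, mul_one]
      · rfl
  · right
    push Not at h
    refine ⟨h, ?_⟩
    rw [cf]
    refine Finset.sum_eq_zero (fun t _ => ?_)
    by_cases ht : t = 0
    · simp [ht]
    · rw [if_neg (h t ht)]

lemma BB_dvd {d M : ℕ} (hN : Fintype.card F = 4 * d * M + 1) (hd : 0 < d) (hM : 0 < M)
    (h2 : ringChar F ≠ 2) : (d : ℤ) ∣ BB F d := by
  rw [BB_cf]
  refine Finset.dvd_sum (fun x _ => ?_)
  apply Dvd.dvd.mul_right
  rcases cf_cases hN hd hM h2 x with ⟨t0, _, _, h⟩ | ⟨_, h⟩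
  · rw [h]; exact ⟨2 * quadraticChar F t0, by ring⟩
  · rw [h]; exact dvd_zero _

variable (p : ℕ) [hp : Fact p.Prime] [CharP F p]

lemma cf_W {d M : ℕ} (hN : Fintype.card F = 4 * d * M + 1) (hd : 0 < d) (hM : 0 < M)
    (h2 : ringChar F ≠ 2) (x : F) :
    (cf d x : WittVector p F) = ∑ j ∈ Finset.range (2 * d), (th p ^ ((2 * j + 1) * M)) x := by
  have hs : ∀ j, (th (F := F) p ^ ((2 * j + 1) * M)) x = (th p x) ^ M * ((th p x) ^ (2 * M)) ^ j := by
    intro j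
    rw [MulChar.pow_apply' _ (by apply Nat.mul_ne_zero <;> omega), ← pow_mul, ← pow_add]
    congr 1; ring
  rw [Finset.sum_congr rfl (fun j _ => hs j), ← Finset.mul_sum]
  rcases cf_cases hN hd hM h2 x with ⟨t0, h0, rfl, h⟩ | ⟨h1, h⟩
  · rw [h]
    have e1 : (th p (t0 ^ (2 * d))) ^ M = chiW p t0 := by
      rw [← th_half p (N := 4 * d * M) (h := 2 * d * M) hN (by ring) h2,
        MulChar.pow_apply' _ (by positivity), map_pow, ← pow_mul]
    have e2 : (th p (t0 ^ (2 * d))) ^ (2 * M) = 1 := by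
      rw [mul_comm 2 M, pow_mul, e1, chiW_apply]
      rcases quadraticChar_dichotomy h0 with h | h <;> rw [h] <;> simp
    rw [e1, e2, chiW_apply]
    push_cast; simp; ring
  · rw [h, Int.cast_zero]
    symm
    by_cases hx : x = 0
    · rw [hx, MulChar.map_zero, zero_pow (by omega), zero_mul]
    · have e : (th p x) ^ (2 * M) ≠ 1 := by
        intro he
        rw [← map_pow, ← map_one (th (F := F) p)] at he
        obtain ⟨t, ht, ht2⟩ := pow_of_pow hN hd hM x hx (th_inj p he)
        exact h1 t ht ht2
      have e2 := mul_geom_sum ((th p x) ^ (2 * M)) (2 * d)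
      have e3 : ((th p x) ^ (2 * M)) ^ (2 * d) = 1 := by
        rw [← pow_mul, ← map_pow, show 2 * M * (2 * d) = Fintype.card F - 1 by
          rw [hN, Nat.add_sub_cancel]; ring, FiniteField.pow_card_sub_one_eq_one x hx, map_one]
      rw [e3, sub_self] at e2
      rw [(mul_eq_zero.1 e2).resolve_left (sub_ne_zero.2 e), mul_zero]

lemma BB_W {d M : ℕ} (hN : Fintype.card F = 4 * d * M + 1) (hd : 0 < d) (hM : 0 < M)
    (h2 : ringChar F ≠ 2) :
    (BB F d : WittVector p F) = ∑ j ∈ Finset.range (2 * d), JJ (F := F) p M (2 * j + 1) := by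
  simp only [BB_cf, JJ, jacobiSum]
  rw [Finset.sum_comm, Int.cast_sum]
  refine Finset.sum_congr rfl (fun x _ => ?_)
  rw [← Finset.sum_mul, ← cf_W p hN hd hM h2 x, chiW_apply, Int.cast_mul]

end BSum
end Cheb

namespace Cheb

set_option linter.unusedSectionVars false
set_option linter.unusedVariables false

section SSum

variable {F : Type} [Field F] [Fintype F] [DecidableEq F]

noncomputable def SS (F : Type) [Field F] [Fintype F] [DecidableEq F] (d : ℕ) : ℤ :=
  ∑ x : F, quadraticChar F ((dickson 1 (1 : F) d).eval x)

noncomputable def DD (F : Type) [Field F] [Fintype F] [DecidableEq F] (d : ℕ) : ℤ :=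
  ∑ x : F, (1 - quadraticChar F (x ^ 2 - 4)) * quadraticChar F ((dickson 1 (1 : F) d).eval x)

lemma rc (h8 : Fintype.card F % 8 = 1) : ringChar F ≠ 2 := by
  intro h
  have := FiniteField.even_card_iff_char_two.1 h
  omega

lemma two_ne (h8 : Fintype.card F % 8 = 1) : (2 : F) ≠ 0 := Ring.two_ne_zero (rc h8)

lemma exists_e (h8 : Fintype.card F % 8 = 1) : ∃ e : F, e ^ 2 = -1 ∧ e ≠ 0 ∧ quadraticChar F e = 1 := by
  obtain ⟨e, he⟩ := (FiniteField.isSquare_neg_one_iff (F := F)).2 (by omega)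
  have he2 : e ^ 2 = -1 := by rw [he]; ring
  have h0 : e ≠ 0 := by rintro rfl; norm_num at he2
  refine ⟨e, he2, h0, ?_⟩
  rw [quadraticChar_one_iff_isSquare h0, FiniteField.isSquare_iff (rc h8) h0]
  obtain ⟨c, hc⟩ : ∃ c, Fintype.card F / 2 = 2 * (2 * c) := ⟨Fintype.card F / 8, by omega⟩
  rw [hc, pow_mul, he2, pow_mul]; simp

lemma chi_sq (x : F) (hx : x ≠ 0) : quadraticChar F x ^ 2 = 1 := quadraticChar_sq_one hx

lemma chi_pow_odd {d : ℕ} (hd : d % 2 = 1) (x : F) : quadraticChar F x ^ d = quadraticChar F x := by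
  by_cases hx : x = 0
  · rw [hx, quadraticChar_zero, zero_pow (by omega)]
  · obtain ⟨c, rfl⟩ : ∃ c, d = 2 * c + 1 := ⟨d / 2, by omega⟩
    rw [pow_succ, pow_mul, chi_sq x hx]; simp

lemma card_fib (h8 : Fintype.card F % 8 = 1) (x : F) :
    ((Finset.univ.filter (fun t : F => t ≠ 0 ∧ t + t⁻¹ = x)).card : ℤ) =
      1 + quadraticChar F (x ^ 2 - 4) := by
  rw [add_comm, ← quadraticChar_card_sqrts (rc h8)]
  have h2 := two_ne h8
  have h4 : (4 : F) ≠ 0 := by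
    rw [show (4 : F) = 2 * 2 by norm_num]; exact mul_ne_zero h2 h2
  congr 1
  refine Finset.card_bij (fun t _ => 2 * t - x) ?_ ?_ ?_
  · intro t ht
    simp only [Finset.mem_filter, Finset.mem_univ, true_and] at ht
    simp only [Set.mem_toFinset, Set.mem_ofPred_eq]
    rw [← ht.2]; field_simp [ht.1]; ring
  · intro a _ b _ h
    have : 2 * a = 2 * b := by linear_combination h
    exact mul_left_cancel₀ h2 this
  · intro s hs
    simp only [Set.mem_toFinset, Set.mem_ofPred_eq] at hs
    have hq : ((s + x) / 2) * ((x - s) / 2) = 1 := by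
      field_simp; linear_combination -hs
    have h0 : (s + x) / 2 ≠ 0 := left_ne_zero_of_mul_eq_one hq
    refine ⟨(s + x) / 2, ?_, by field_simp; ring⟩
    simp only [Finset.mem_filter, Finset.mem_univ, true_and]
    refine ⟨h0, ?_⟩
    rw [inv_eq_of_mul_eq_one_right hq]; field_simp; ring

lemma two_SS (h8 : Fintype.card F % 8 = 1) {d : ℕ} (hd : d % 2 = 1) :
    2 * SS F d = BB F d + DD F d := by
  have key : ∑ x : F, (1 + quadraticChar F (x ^ 2 - 4)) *
      quadraticChar F ((dickson 1 (1 : F) d).eval x) = BB F d := by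
    have e1 : ∀ x : F, (1 + quadraticChar F (x ^ 2 - 4)) *
      quadraticChar F ((dickson 1 (1 : F) d).eval x) =
        ∑ t : F, if t ≠ 0 ∧ t + t⁻¹ = x then quadraticChar F t * quadraticChar F (1 + t ^ (2 * d)) else 0 := by
      intro x
      rw [← card_fib h8 x, ← Finset.sum_filter, ← nsmul_eq_mul, ← Finset.sum_const]
      refine Finset.sum_congr rfl (fun t ht => ?_)
      simp only [Finset.mem_filter, Finset.mem_univ, true_and] at ht
      obtain ⟨h0, rfl⟩ := ht
      rw [dickson_one_one_eval_add_inv _ _ (mul_inv_cancel₀ h0)]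
      have : t ^ d * (t ^ d + t⁻¹ ^ d) = 1 + t ^ (2 * d) := by
        rw [mul_add, ← mul_pow t t⁻¹, mul_inv_cancel₀ h0, ← pow_add, one_pow, add_comm, two_mul]
      rw [← this, map_mul, ← mul_assoc, map_pow, chi_pow_odd hd, ← sq, chi_sq t h0, one_mul]
    rw [Finset.sum_congr rfl (fun x _ => e1 x), Finset.sum_comm]
    have e2 : ∀ t : F, (∑ x : F, if t ≠ 0 ∧ t + t⁻¹ = x then
        quadraticChar F t * quadraticChar F (1 + t ^ (2 * d)) else 0) =
        quadraticChar F t * quadraticChar F (1 + t ^ (2 * d)) := by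
      intro t
      by_cases h0 : t = 0
      · simp [h0]
      · simp [h0]
    rw [Finset.sum_congr rfl (fun x _ => e2 x), BB]
    obtain ⟨e, he, he0, hec⟩ := exists_e h8
    refine (Fintype.sum_equiv (Equiv.mulLeft₀ e he0) _ _ (fun t => ?_)).symm
    simp only [Equiv.mulLeft₀_apply, map_mul, hec, one_mul]
    have hm : (-1 : F) ^ d = -1 := Odd.neg_one_pow (Nat.odd_iff.2 hd)
    rw [mul_pow, pow_mul e, he, hm]; congr 2; ring
  rw [← key, DD, ← Finset.sum_add_distrib, SS, Finset.mul_sum]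
  refine Finset.sum_congr rfl (fun x _ => ?_)
  ring

lemma SS_one (h8 : Fintype.card F % 8 = 1) : SS F 1 = 0 := by
  rw [SS]
  simp only [dickson_one, eval_X]
  exact quadraticChar_sum_zero (rc h8)

lemma DD_one (h8 : Fintype.card F % 8 = 1) : DD F 1 = - BB F 1 := by
  have := two_SS (F := F) h8 (d := 1) rfl
  rw [SS_one h8] at this
  linarith

lemma pow_inj_of_coprime {K : Type*} [Field K] {d m : ℕ} (h : d.Coprime m) {a b : K} (hb : b ≠ 0)
    (ham : a ^ m = 1) (hbm : b ^ m = 1) (hab : a ^ d = b ^ d) : a = b := by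
  have h1 : (a / b) ^ d = 1 := by rw [div_pow, hab, div_self (pow_ne_zero _ hb)]
  have h2 : (a / b) ^ m = 1 := by rw [div_pow, ham, hbm, div_one]
  have h3 := pow_gcd_eq_one.2 ⟨h1, h2⟩
  rw [h, pow_one, div_eq_one_iff_eq hb] at h3
  exact h3

lemma BB_coprime (h8 : Fintype.card F % 8 = 1) {d : ℕ} (hd : d % 2 = 1)
    (h : d.Coprime (Fintype.card F - 1)) : BB F d = BB F 1 := by
  rw [BB, BB]
  have hinj : Function.Injective (fun t : F => t ^ d) := by
    intro a b hab
    simp only at hab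
    by_cases hb : b = 0
    · rw [hb, zero_pow (by omega)] at hab
      rw [hb]; exact (pow_eq_zero_iff (by omega)).1 hab
    · have ha : a ≠ 0 := by
        rintro rfl
        rw [zero_pow (by omega)] at hab
        exact pow_ne_zero d hb hab.symm
      exact pow_inj_of_coprime h hb (FiniteField.pow_card_sub_one_eq_one a ha)
        (FiniteField.pow_card_sub_one_eq_one b hb) hab
  refine Fintype.sum_bijective _ (Finite.injective_iff_bijective.1 hinj) _ _ (fun t => ?_)
  simp only [map_pow, chi_pow_odd hd, mul_one]
  rw [← pow_mul, mul_comm 2 d]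

/-- characterisation of the set `χ(x²-4) ≠ 1` through the algebraic closure -/
lemma U_iff (h8 : Fintype.card F % 8 = 1) {K : Type} [Field K] [Algebra F K] (x : F) (t : K)
    (ht : t ≠ 0) (hx : algebraMap F K x = t + t⁻¹) :
    quadraticChar F (x ^ 2 - 4) ≠ 1 ↔ t ^ (Fintype.card F + 1) = 1 := by
  obtain ⟨p, hp1⟩ := CharP.exists F
  have hpr : p.Prime := CharP.char_is_prime F p
  have : Fact p.Prime := ⟨hpr⟩
  obtain ⟨n, hn⟩ := FiniteField.card F p
  have : CharP K p := charP_of_injective_algebraMap (algebraMap F K).injective p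
  set Q := Fintype.card F with hQ
  have hF : ∀ y : F, (algebraMap F K y) ^ Q = algebraMap F K y := by
    intro y; rw [← map_pow, FiniteField.pow_card]
  have h2 : (2 : K) ≠ 0 := by
    have := (map_ne_zero (algebraMap F K)).2 (two_ne h8)
    rwa [map_ofNat] at this
  have hs2 : (t - t⁻¹) ^ 2 = algebraMap F K (x ^ 2 - 4) := by
    rw [map_sub, map_pow, hx, map_ofNat]; field_simp; ring
  have hodd : Q % 2 = 1 := by omega
  have htQ : (t + t⁻¹) ^ Q = t ^ Q + t⁻¹ ^ Q := by
    rw [hn.2]; exact add_pow_char_pow _ _ _ _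
  have htQ' : (t - t⁻¹) ^ Q = t ^ Q - t⁻¹ ^ Q := by
    rw [hn.2]; exact sub_pow_char_pow _ _ _
  have hsum : t ^ Q + t⁻¹ ^ Q = t + t⁻¹ := by rw [← htQ, ← hx, hF]
  have hsQ : (t - t⁻¹) ^ Q = - (t - t⁻¹) ↔ t ^ (Q + 1) = 1 := by
    rw [htQ', pow_succ]
    constructor
    · intro h
      have : 2 * t ^ Q = 2 * t⁻¹ := by linear_combination h + hsum
      rw [mul_left_cancel₀ h2 this, inv_mul_cancel₀ ht]
    · intro h
      have h1 : t ^ Q = t⁻¹ := eq_inv_of_mul_eq_one_left h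
      rw [inv_pow, h1, inv_inv]; ring
  rw [← hsQ]
  obtain ⟨c, hc⟩ : ∃ c, Q = 2 * c + 1 := ⟨Q / 2, by omega⟩
  have hsc : (t - t⁻¹) ^ Q = (algebraMap F K (x ^ 2 - 4)) ^ c * (t - t⁻¹) := by
    rw [hc, pow_succ, pow_mul, hs2]
  have hch := quadraticChar_eq_pow_of_char_ne_two' (rc h8) (x ^ 2 - 4)
  rw [← hQ, show Q / 2 = c by omega] at hch
  rw [hsc, ← map_pow, ← hch]
  by_cases h0 : t - t⁻¹ = 0
  · have hz : x ^ 2 - 4 = 0 := by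
      rw [h0, zero_pow two_ne_zero] at hs2
      exact (map_eq_zero _).1 hs2.symm
    rw [hz, h0]; simp
  · have hz : x ^ 2 - 4 ≠ 0 := by
      intro hz
      rw [hz, map_zero] at hs2
      exact h0 ((pow_eq_zero_iff two_ne_zero).1 hs2)
    rcases quadraticChar_dichotomy hz with h | h
    · rw [h]
      simp only [ne_eq, not_true_eq_false, Int.cast_one, map_one, one_mul, false_iff]
      intro h'
      have : 2 * (t - t⁻¹) = 0 := by linear_combination h'
      exact h0 ((mul_eq_zero.1 this).resolve_left h2)
    · rw [h]; simp

lemma exists_t (h8 : Fintype.card F % 8 = 1) {K : Type} [Field K] [Algebra F K] [IsAlgClosed K]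
    (x : F) : ∃ t : K, t ≠ 0 ∧ algebraMap F K x = t + t⁻¹ := by
  have h2 : (2 : K) ≠ 0 := by
    have := (map_ne_zero (algebraMap F K)).2 (two_ne h8)
    rwa [map_ofNat] at this
  obtain ⟨s, hs⟩ := IsAlgClosed.exists_pow_nat_eq (algebraMap F K x ^ 2 - 4) (n := 2) (by norm_num)
  set y := algebraMap F K x
  have hq : ((s + y) / 2) * ((y - s) / 2) = 1 := by
    have h4 : (4 : K) ≠ 0 := by
      rw [show (4 : K) = 2 * 2 by norm_num]; exact mul_ne_zero h2 h2
    field_simp; linear_combination -hs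
  refine ⟨(s + y) / 2, left_ne_zero_of_mul_eq_one hq, ?_⟩
  rw [inv_eq_of_mul_eq_one_right hq]; field_simp; ring

lemma dick_map {K : Type} [Field K] [Algebra F K] (x : F) (t : K) (ht : t ≠ 0)
    (hx : algebraMap F K x = t + t⁻¹) (d : ℕ) :
    algebraMap F K ((dickson 1 (1 : F) d).eval x) = t ^ d + (t ^ d)⁻¹ := by
  rw [← eval_map_apply, map_dickson, map_one, hx, dickson_one_one_eval_add_inv _ _ (mul_inv_cancel₀ ht),
    inv_pow]

lemma DD_coprime (h8 : Fintype.card F % 8 = 1) {d : ℕ} (hd : d % 2 = 1)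
    (h : d.Coprime (Fintype.card F + 1)) : DD F d = DD F 1 := by
  let K := AlgebraicClosure F
  let U : Finset F := Finset.univ.filter (fun x => quadraticChar F (x ^ 2 - 4) ≠ 1)
  have hmem : ∀ x, x ∈ U ↔ quadraticChar F (x ^ 2 - 4) ≠ 1 := by intro x; simp [U]
  have hDD : ∀ j, DD F j = ∑ x ∈ U, (1 - quadraticChar F (x ^ 2 - 4)) *
      quadraticChar F ((dickson 1 (1 : F) j).eval x) := by
    intro j
    rw [DD]
    symm
    apply Finset.sum_subset (Finset.subset_univ U)
    intro x _ hx
    rw [hmem] at hx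
    push Not at hx
    rw [hx]; simp
  have hmap : ∀ x ∈ U, (dickson 1 (1 : F) d).eval x ∈ U := by
    intro x hx
    rw [hmem] at hx ⊢
    obtain ⟨t, ht, hxt⟩ := exists_t (K := K) h8 x
    rw [U_iff h8 x t ht hxt] at hx
    rw [U_iff h8 _ (t ^ d) (pow_ne_zero d ht) (dick_map x t ht hxt d), ← pow_mul, mul_comm, pow_mul,
      hx, one_pow]
  have hinj : Set.InjOn (fun x => (dickson 1 (1 : F) d).eval x) (U : Set F) := by
    intro x hx y hy hxy
    rw [Finset.mem_coe, hmem] at hx hy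
    obtain ⟨t, ht, hxt⟩ := exists_t (K := K) h8 x
    obtain ⟨r, hr, hyr⟩ := exists_t (K := K) h8 y
    rw [U_iff h8 x t ht hxt] at hx
    rw [U_iff h8 y r hr hyr] at hy
    have h1 := congrArg (algebraMap F K) hxy
    simp only at h1
    rw [dick_map x t ht hxt d, dick_map y r hr hyr d] at h1
    have htd := pow_ne_zero d ht
    have hrd := pow_ne_zero d hr
    have h2 : (t ^ d - r ^ d) * (t ^ d - (r ^ d)⁻¹) = 0 := by
      have e1 := mul_inv_cancel₀ htd
      have e2 := mul_inv_cancel₀ hrd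
      linear_combination t ^ d * h1 - e1 + e2
    apply (algebraMap F K).injective
    rw [hxt, hyr]
    rcases mul_eq_zero.1 h2 with h3 | h3
    · rw [pow_inj_of_coprime h hr hx hy (sub_eq_zero.1 h3)]
    · rw [← inv_pow] at h3
      rw [pow_inj_of_coprime h (inv_ne_zero hr) hx (by rw [inv_pow, hy, inv_one]) (sub_eq_zero.1 h3)]
      rw [inv_inv, add_comm]
  have hw : ∀ x ∈ U, quadraticChar F (((dickson 1 (1 : F) d).eval x) ^ 2 - 4) =
      quadraticChar F (x ^ 2 - 4) := by
    intro x hx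
    have hx' := hmap x hx
    rw [hmem] at hx hx'
    obtain ⟨t, ht, hxt⟩ := exists_t (K := K) h8 x
    have hz : ∀ (y : F) (s : K), s ≠ 0 → algebraMap F K y = s + s⁻¹ → (y ^ 2 - 4 = 0 ↔ s ^ 2 = 1) := by
      intro y s hs hys
      rw [← map_eq_zero (algebraMap F K), map_sub, map_pow, hys, map_ofNat]
      have : (s + s⁻¹) ^ 2 - 4 = (s - s⁻¹) ^ 2 := by
        linear_combination 4 * mul_inv_cancel₀ hs
      rw [this, pow_eq_zero_iff two_ne_zero, sub_eq_zero, sq]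
      constructor
      · intro h; nth_rw 1 [h]; exact inv_mul_cancel₀ hs
      · intro h; exact eq_inv_of_mul_eq_one_left h
    have h1 : (((dickson 1 (1 : F) d).eval x) ^ 2 - 4 = 0) ↔ (x ^ 2 - 4 = 0) := by
      rw [hz x t ht hxt, hz _ (t ^ d) (pow_ne_zero d ht) (dick_map x t ht hxt d)]
      rw [U_iff h8 x t ht hxt] at hx
      constructor
      · intro h3
        apply pow_inj_of_coprime h one_ne_zero (by rw [← pow_mul, mul_comm, pow_mul, hx, one_pow])
          (one_pow _)
        rw [one_pow, ← pow_mul, mul_comm, pow_mul, h3]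
      · intro h3
        rw [← pow_mul, mul_comm, pow_mul, h3, one_pow]
    by_cases h0 : x ^ 2 - 4 = 0
    · rw [h0, h1.2 h0]
    · rw [(quadraticChar_dichotomy h0).resolve_left hx,
        (quadraticChar_dichotomy (fun h => h0 (h1.1 h))).resolve_left hx']
  rw [hDD, hDD]
  refine Finset.sum_nbij (fun x => (dickson 1 (1 : F) d).eval x) hmap hinj ?_ ?_
  · exact Finset.surjOn_of_injOn_of_card_le _ hmap hinj le_rfl
  · intro x hx
    simp only [dickson_one, eval_X]
    rw [hw x hx]

lemma SS_eq (h8 : Fintype.card F % 8 = 1) {d : ℕ} (hd : d % 2 = 1)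
    (h : d.Coprime (Fintype.card F + 1)) : 2 * SS F d = BB F d - BB F 1 := by
  rw [two_SS h8 hd, DD_coprime h8 hd h, DD_one h8]; ring

lemma SS_zero (h8 : Fintype.card F % 8 = 1) {d : ℕ} (hd : d % 2 = 1)
    (h : d.Coprime (Fintype.card F + 1)) (h' : d.Coprime (Fintype.card F - 1)) : SS F d = 0 := by
  have := SS_eq h8 hd h
  rw [BB_coprime h8 hd h'] at this
  linarith

end SSum
end Cheb

namespace Cheb

set_option linter.unusedSectionVars false
set_option linter.unusedVariables false

section Arch

variable {F : Type} [Field F] [Fintype F] [DecidableEq F]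

lemma count_eq (h8 : Fintype.card F % 8 = 1) (d : ℕ) :
    ((Nat.card {xy : F × F // xy.2 ^ 2 = (dickson 1 (1 : F) d).eval xy.1} : ℕ) : ℤ) =
      Fintype.card F + SS F d := by
  have e : {xy : F × F // xy.2 ^ 2 = (dickson 1 (1 : F) d).eval xy.1} ≃
      Σ x : F, {y : F // y ^ 2 = (dickson 1 (1 : F) d).eval x} :=
    { toFun := fun z => ⟨z.1.1, z.1.2, z.2⟩
      invFun := fun z => ⟨(z.1, z.2.1), z.2.2⟩
      left_inv := fun z => rfl
      right_inv := fun z => rfl }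
  rw [Nat.card_congr e, Nat.card_sigma]
  push_cast
  have h1 : ∀ x : F, ((Nat.card {y : F // y ^ 2 = (dickson 1 (1 : F) d).eval x} : ℕ) : ℤ) =
      quadraticChar F ((dickson 1 (1 : F) d).eval x) + 1 := by
    intro x
    rw [← quadraticChar_card_sqrts (rc h8), Nat.card_eq_fintype_card, Fintype.card_subtype]
    congr 2
    ext y; simp
  rw [Finset.sum_congr rfl (fun x _ => h1 x), Finset.sum_add_distrib, SS]
  simp [add_comm]

variable (p : ℕ) [hp : Fact p.Prime] [CharP F p]

lemma JJ_norm {d M a : ℕ} (hN : Fintype.card F = 4 * d * M + 1)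
    (hM : 0 < M) (hd : 0 < d) (ha : a < 4 * d) (hodd : a % 2 = 1) (h2 : ringChar F ≠ 2)
    (ι : WittVector p F →+* ℂ) (hι : Function.Injective ι) :
    ‖ι (JJ (F := F) p M a)‖ ^ 2 = Fintype.card F := by
  have hne : ∀ m : ℕ, ¬ 4 * d * M ∣ m → ((th (F := F) p) ^ m).ringHomComp ι ≠ 1 := by
    intro m hm
    rw [MulChar.ringHomComp_ne_one_iff hι]
    exact th_pow_ne_one p hN hm
  have hth := th_half (F := F) p (N := 4 * d * M) (h := 2 * d * M) hN (by ring) h2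
  have hdd : ∀ b, 0 < b → b < 4 * d → ¬ 4 * d * M ∣ b * M := by
    intro b hb hb4 h
    have := Nat.dvd_of_mul_dvd_mul_right hM h
    have := Nat.le_of_dvd hb this
    omega
  have hrc : ringChar ℂ ≠ ringChar F := by
    rw [ringChar.eq_zero]
    intro h
    have := CharP.ringChar_ne_zero_of_finite F
    exact this h.symm
  have h3 := jacobiSum_mul_jacobiSum_inv hrc (χ := ((th (F := F) p) ^ (a * M)).ringHomComp ι)
    (φ := ((th (F := F) p) ^ (2 * d * M)).ringHomComp ι) (hne _ (hdd a (by omega) ha))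
    (hne _ (hdd (2 * d) (by omega) (by omega))) (by
      rw [← MulChar.ringHomComp_mul, ← pow_add]
      apply hne
      intro h
      have : 4 * d * M ∣ (a + 2 * d) * M := by rwa [add_mul]
      have := Nat.dvd_of_mul_dvd_mul_right hM this
      obtain ⟨c, hc⟩ := this
      have : a + 2 * d = 2 * (2 * d * c) := by rw [hc]; ring
      omega)
  rw [← MulChar.star_eq_inv, ← MulChar.star_eq_inv] at h3
  have h4 : jacobiSum (star (((th (F := F) p) ^ (a * M)).ringHomComp ι))
      (star (((th (F := F) p) ^ (2 * d * M)).ringHomComp ι)) =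
      (starRingEnd ℂ) (jacobiSum (((th (F := F) p) ^ (a * M)).ringHomComp ι)
      (((th (F := F) p) ^ (2 * d * M)).ringHomComp ι)) := by
    rw [jacobiSum, jacobiSum, map_sum]
    refine Finset.sum_congr rfl (fun x _ => ?_)
    rw [map_mul]; rfl
  rw [h4, jacobiSum_ringHomComp, hth, Complex.mul_conj] at h3
  rw [← Complex.normSq_eq_norm_sq, JJ]
  exact_mod_cast h3

lemma JJ_scale (d M a : ℕ) : JJ (F := F) p (d * M) a = JJ p M (a * d) := by
  rw [JJ, JJ, mul_assoc]

/-- odd residues mod `4 l` prime to `l`, listed as `2 j + 1` -/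
def EE (l : ℕ) : Finset ℕ := (Finset.range (2 * l)).filter (fun j => ¬ l ∣ 2 * j + 1)

lemma EE_compl {l : ℕ} (hl : l % 2 = 1) :
    (Finset.range (2 * l)).filter (fun j => ¬ ¬ l ∣ 2 * j + 1) = {(l - 1) / 2, (3 * l - 1) / 2} := by
  ext j
  simp only [Finset.mem_filter, Finset.mem_range, not_not, Finset.mem_insert, Finset.mem_singleton]
  constructor
  · rintro ⟨h1, c, hc⟩
    have : c < 4 := by
      by_contra h; push Not at h; nlinarith
    interval_cases c <;> omega
  · rintro (h | h)
    · exact ⟨by omega, 1, by omega⟩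
    · exact ⟨by omega, 3, by omega⟩

lemma EE_card {l : ℕ} (hl : l % 2 = 1) : (EE l).card + 2 = 2 * l := by
  have h := Finset.card_filter_add_card_filter_not (s := Finset.range (2 * l)) (fun j => ¬ l ∣ 2 * j + 1)
  rw [EE_compl hl, Finset.card_range, Finset.card_pair (by omega)] at h
  exact h

lemma SS_W (h8 : Fintype.card F % 8 = 1) {l M : ℕ} (hN : Fintype.card F = 4 * l * M + 1) (hM : 0 < M)
    (hl : l % 2 = 1) (hc : l.Coprime (Fintype.card F + 1)) :
    ((2 * SS F l : ℤ) : WittVector p F) = ∑ j ∈ EE l, JJ (F := F) p M (2 * j + 1) := by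
  have h2 := rc h8
  rw [SS_eq h8 hl hc, Int.cast_sub, BB_W p hN (by omega) hM h2,
    BB_W p (d := 1) (M := l * M) (by rw [hN]; ring) (by omega) (by apply Nat.mul_pos <;> omega) h2]
  rw [← Finset.sum_filter_add_sum_filter_not (Finset.range (2 * l)) (fun j => ¬ l ∣ 2 * j + 1),
    EE_compl hl, Finset.sum_pair (by omega)]
  simp only [mul_one, Finset.sum_range_succ, Finset.sum_range_zero, JJ_scale]
  rw [show 2 * ((l - 1) / 2) + 1 = l by omega, show 2 * ((3 * l - 1) / 2) + 1 = 3 * l by omega, EE]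
  simp

lemma JJ_norm' {d M a q : ℕ} (hN : Fintype.card F = 4 * d * M + 1) (hq : Fintype.card F = q ^ 2)
    (hM : 0 < M) (hd : 0 < d) (ha : a < 4 * d) (hodd : a % 2 = 1) (h2 : ringChar F ≠ 2)
    (ι : WittVector p F →+* ℂ) (hι : Function.Injective ι) :
    ‖ι (JJ (F := F) p M a)‖ = q := by
  have := JJ_norm p hN hM hd ha hodd h2 ι hι
  rw [hq] at this
  push_cast at this
  exact (sq_eq_sq₀ (norm_nonneg _) (Nat.cast_nonneg _)).1 this

lemma EE_lt {l j : ℕ} (h : j ∈ EE l) : 2 * j + 1 < 4 * l := by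
  simp only [EE, Finset.mem_filter, Finset.mem_range] at h
  omega

lemma SS_bound (p : ℕ) [Fact p.Prime] [CharP F p] (h8 : Fintype.card F % 8 = 1) {l M q : ℕ} (hN : Fintype.card F = 4 * l * M + 1)
    (hq : Fintype.card F = q ^ 2) (hM : 0 < M)
    (hl : l % 2 = 1) (hc : l.Coprime (Fintype.card F + 1)) :
    |2 * SS F l| ≤ (2 * l - 2) * q := by
  obtain ⟨ι, hι⟩ := exists_embed (F := F) p
  have h := congrArg ι (SS_W p h8 hN hM hl hc)
  rw [map_intCast, map_sum] at h
  have h1 := norm_sum_le (EE l) (fun j => ι (JJ (F := F) p M (2 * j + 1)))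
  rw [← h, Finset.sum_congr rfl (fun j hj => JJ_norm' p hN hq hM (by omega) (EE_lt hj) (by omega)
    (rc h8) ι hι), Finset.sum_const, nsmul_eq_mul, Complex.norm_intCast] at h1
  have h2 : ((EE l).card : ℤ) = 2 * l - 2 := by have := EE_card hl; omega
  rw [← h2]
  exact_mod_cast h1

lemma SS_extreme (h8 : Fintype.card F % 8 = 1) {l M q : ℕ} (hN : Fintype.card F = 4 * l * M + 1)
    (hq : Fintype.card F = q ^ 2) (hM : 0 < M)
    (hl : l % 2 = 1) (hc : l.Coprime (Fintype.card F + 1)) (hS : SS F l = (l - 1) * q) :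
    ∀ j ∈ EE l, JJ (F := F) p M (2 * j + 1) = (q : WittVector p F) := by
  obtain ⟨ι, hι⟩ := exists_embed (F := F) p
  have h := congrArg ι (SS_W p h8 hN hM hl hc)
  rw [map_intCast, map_sum] at h
  have hn : ∀ j ∈ EE l, ‖ι (JJ (F := F) p M (2 * j + 1))‖ = q := fun j hj =>
    JJ_norm' p hN hq hM (by omega) (EE_lt hj) (by omega) (rc h8) ι hι
  have h2 : ((EE l).card : ℤ) = 2 * l - 2 := by have := EE_card hl; omega
  have h3 : (2 * SS F l : ℤ) = (EE l).card * q := by rw [h2, hS]; ring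
  rw [h3] at h
  have h4 : ∑ j ∈ EE l, ((q : ℝ) - (ι (JJ (F := F) p M (2 * j + 1))).re) = 0 := by
    rw [Finset.sum_sub_distrib, ← Complex.re_sum, ← h]
    simp
  have h5 := (Finset.sum_eq_zero_iff_of_nonneg (fun j hj => by
    have := Complex.re_le_norm (ι (JJ (F := F) p M (2 * j + 1)))
    rw [hn j hj] at this; linarith)).1 h4
  intro j hj
  have h6 := h5 j hj
  have h7 := hn j hj
  apply hι
  rw [map_natCast]
  set z := ι (JJ (F := F) p M (2 * j + 1))
  have hre : z.re = q := by linarith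
  have h8 := Complex.sq_norm z
  rw [h7, Complex.normSq_apply, hre] at h8
  have him : z.im = 0 := by nlinarith
  apply Complex.ext
  · rw [hre]; simp
  · rw [him]; simp

end Arch
end Cheb

namespace Cheb

set_option linter.unusedSectionVars false
set_option linter.unusedVariables false

section Comb

def GG (k c : ℕ) : ℕ := if k < c % (4 * k + 1) ∧ c % (4 * k + 1) ≤ 3 * k then 1 else 0

lemma GG_congr {k c c' : ℕ} (h : c % (4 * k + 1) = c' % (4 * k + 1)) : GG k c = GG k c' := by
  rw [GG, GG, h]

lemma GG_neg {k c c' : ℕ} (h : (c + c') % (4 * k + 1) = 0) : GG k c = GG k c' := by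
  rw [GG, GG]
  have h1 : c % (4 * k + 1) < 4 * k + 1 := Nat.mod_lt _ (by omega)
  have h2 : c' % (4 * k + 1) < 4 * k + 1 := Nat.mod_lt _ (by omega)
  rw [Nat.add_mod] at h
  set x := c % (4 * k + 1)
  set y := c' % (4 * k + 1)
  have : x + y = 0 ∨ x + y = 4 * k + 1 := by
    obtain ⟨z, hz⟩ := Nat.dvd_of_mod_eq_zero h
    have : z < 2 := by
      by_contra h; push Not at h; nlinarith
    interval_cases z <;> omega
  congr 1
  apply propext
  omega

lemma rr_mod (p f l a : ℕ) : rr p f l (a % (4 * l)) = rr p f l a := by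
  rw [rr, rr]
  congr 1
  refine Finset.filter_congr (fun i _ => ?_)
  rw [Nat.mul_mod, Nat.mod_mod, ← Nat.mul_mod]

lemma rr_aux {p l k : ℕ} (hlk : l = 4 * k + 1) (hp4 : p % 4 = 1) (s c i : ℕ) :
    (p ^ i * (4 * c + s * l)) % (4 * l) = (4 * ((p ^ i * c) % l) + s * l) % (4 * l) := by
  have h1 : p ^ i % 4 = 1 := by rw [Nat.pow_mod, hp4]; simp
  obtain ⟨z, hz⟩ : ∃ z, p ^ i = 4 * z + 1 := ⟨p ^ i / 4, by omega⟩
  have h2 : p ^ i * (4 * c + s * l) = 4 * (p ^ i * c) + s * l + 4 * l * (s * z) := by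
    rw [hz]; ring
  rw [h2, Nat.add_mul_mod_self_left]
  conv_lhs => rw [← Nat.div_add_mod (p ^ i * c) l]
  rw [show 4 * (l * (p ^ i * c / l) + p ^ i * c % l) + s * l =
    4 * (p ^ i * c % l) + s * l + 4 * l * (p ^ i * c / l) by ring, Nat.add_mul_mod_self_left]

lemma rr_G {p l k : ℕ} (hlk : l = 4 * k + 1) (hp4 : p % 4 = 1) (f c : ℕ) :
    rr p f l (4 * c + l) = ∑ i ∈ Finset.range f, GG k (p ^ i * c) := by
  rw [rr, Finset.card_filter]
  refine Finset.sum_congr rfl (fun i _ => ?_)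
  have h := rr_aux hlk hp4 1 c i
  rw [one_mul] at h
  rw [h, GG, ← hlk]
  have h1 : (p ^ i * c) % l < l := Nat.mod_lt _ (by omega)
  set x := (p ^ i * c) % l
  congr 1
  apply propext
  by_cases hx : x ≤ 3 * k
  · rw [Nat.mod_eq_of_lt (by omega)]; omega
  · rw [show 4 * x + l = 4 * x + l - 4 * l + 4 * l by omega, Nat.add_mod_right,
      Nat.mod_eq_of_lt (by omega)]; omega

lemma rr_G3 {p l k : ℕ} (hlk : l = 4 * k + 1) (hp4 : p % 4 = 1) (f c : ℕ) :
    rr p f l (4 * c + 3 * l) + ∑ i ∈ Finset.range f, GG k (p ^ i * c) = f := by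
  rw [rr, Finset.card_filter, ← Finset.sum_add_distrib, Finset.sum_congr rfl (g := fun _ => 1)]
  · simp
  intro i _
  have h := rr_aux hlk hp4 3 c i
  rw [h, GG, ← hlk]
  have h1 : (p ^ i * c) % l < l := Nat.mod_lt _ (by omega)
  set x := (p ^ i * c) % l
  by_cases hx : x ≤ k
  · rw [Nat.mod_eq_of_lt (by omega)]; rw [if_pos (by omega), if_neg (by omega)]
  · rw [show 4 * x + 3 * l = 4 * x + 3 * l - 4 * l + 4 * l by omega, Nat.add_mod_right,
      Nat.mod_eq_of_lt (by omega)]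
    by_cases hx3 : x ≤ 3 * k
    · rw [if_neg (by omega), if_pos (by omega)]
    · rw [if_pos (by omega), if_neg (by omega)]

lemma block_sum (k p A B c : ℕ) (h : ∀ j, ∑ i ∈ Finset.range A, GG k (p ^ i * (p ^ (A * j) * c)) = B)
    (m : ℕ) : ∑ i ∈ Finset.range (A * m), GG k (p ^ i * c) = m * B := by
  induction m with
  | zero => simp
  | succ m ih =>
    rw [Nat.mul_succ, Finset.sum_range_add, ih, add_mul, one_mul, ← h m]
    congr 1
    refine Finset.sum_congr rfl (fun i _ => ?_)
    rw [pow_add]; congr 1; ring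

lemma comb_even {k p l n : ℕ} (hl : l.Prime) (hlk : l = 4 * k + 1) (hpl : ¬ l ∣ p) (hn : 0 < n)
    (h : ∀ c, ¬ l ∣ c → ∑ i ∈ Finset.range (2 * n), GG k (p ^ i * c) = n)
    (A : ℕ) (hA : ∀ c, GG k (p ^ A * c) = GG k c) (c : ℕ) (hc : ¬ l ∣ c) :
    2 * ∑ i ∈ Finset.range A, GG k (p ^ i * c) = A := by
  have h1 := block_sum k p (2 * n) n c (fun j => h _ (fun hd => by
    rcases (Nat.Prime.dvd_mul hl).1 hd with h | h
    · exact hpl (hl.dvd_of_dvd_pow h)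
    · exact hc h)) A
  have hA' : ∀ j c, GG k (p ^ (A * j) * c) = GG k c := by
    intro j
    induction j with
    | zero => simp
    | succ j ih => intro c; rw [Nat.mul_succ, pow_add, mul_assoc, ih, hA]
  have h2 := block_sum k p A (∑ i ∈ Finset.range A, GG k (p ^ i * c)) c (fun j => by
    refine Finset.sum_congr rfl (fun i _ => ?_)
    rw [mul_left_comm, hA']) (2 * n)
  rw [mul_comm A, h1] at h2
  have : n * (2 * ∑ i ∈ Finset.range A, GG k (p ^ i * c)) = n * A := by
    rw [mul_comm n A, h2]; ring
  exact Nat.eq_of_mul_eq_mul_left hn this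

lemma sq_one_cases {K : Type*} [Field K] {a : K} (h : a ^ 2 = 1) : a = 1 ∨ a = -1 := by
  rw [sq] at h
  exact mul_self_eq_one_iff.1 h

lemma comb_conv {k p l n : ℕ} (hl : l.Prime) (hlk : l = 4 * k + 1) (hk : k = 1 ∨ k.Prime)
    (hpl : ¬ l ∣ p) (hn : 0 < n)
    (h : ∀ c, ¬ l ∣ c → ∑ i ∈ Finset.range (2 * n), GG k (p ^ i * c) = n)
    (u : (ZMod l)ˣ) (hu : (u : ZMod l) = (p : ZMod l)) :
    ∀ x : (ZMod l)ˣ, x ∈ Subgroup.zpowers u := by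
  have : Fact l.Prime := ⟨hl⟩
  have hk2 : k ≠ 2 := by rintro rfl; subst hlk; revert hl; norm_num
  have hkodd : k % 2 = 1 := by
    rcases hk with h | h
    · omega
    · rcases h.eq_two_or_odd with h | h <;> omega
  have hper : ∀ A : ℕ, ((p : ZMod l) ^ A = 1 ∨ (p : ZMod l) ^ A = -1) →
      ∀ c, GG k (p ^ A * c) = GG k c := by
    rintro A (hA | hA) c
    · apply GG_congr
      rw [← hlk]
      apply (ZMod.natCast_eq_natCast_iff' _ _ _).1
      push_cast; rw [hA, one_mul]
    · apply GG_neg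
      rw [← hlk]
      apply Nat.mod_eq_zero_of_dvd
      rw [← ZMod.natCast_eq_zero_iff]
      push_cast; rw [hA]; ring
  have hnk : ¬ ((p : ZMod l) ^ k = 1 ∨ (p : ZMod l) ^ k = -1) := by
    intro hh
    have := comb_even hl hlk hpl hn h k (hper k hh) 1 (by
      intro h; have := Nat.le_of_dvd one_pos h; have := hl.two_le; omega)
    omega
  have hn2 : ¬ ((p : ZMod l) ^ 2 = -1 ∧ k ≠ 1) := by
    rintro ⟨hh, hk1⟩
    have h3 := comb_even hl hlk hpl hn h 2 (hper 2 (Or.inr hh))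
    have hnd : ∀ c, 0 < c → c < l → ¬ l ∣ c := by
      intro c hc hcl hd; have := Nat.le_of_dvd hc hd; omega
    have a1 := h3 1 (hnd 1 (by omega) (by omega))
    have a2 := h3 2 (hnd 2 (by omega) (by omega))
    have a3 := h3 3 (hnd 3 (by omega) (by omega))
    simp only [Finset.sum_range_succ, Finset.sum_range_zero, pow_zero, one_mul, pow_one, zero_add,
      mul_one] at a1 a2 a3
    have b1 : GG k 1 = 0 := by
      rw [GG, Nat.mod_eq_of_lt (by omega), if_neg (by omega)]
    have b2 : GG k 2 = 0 := by
      rw [GG, Nat.mod_eq_of_lt (by omega), if_neg (by omega)]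
    have b3 : GG k 3 = 0 := by
      rw [GG, Nat.mod_eq_of_lt (by omega), if_neg (by omega)]
    set r := p % l with hr
    have c2 : GG k (p * 2) = GG k (r * 2) := GG_congr (by rw [hr, ← hlk]; simp [Nat.mod_mul_mod])
    have c3 : GG k (p * 3) = GG k (r * 3) := GG_congr (by rw [hr, ← hlk]; simp [Nat.mod_mul_mod])
    have c1 : GG k p = GG k r := GG_congr (by rw [hr, ← hlk]; simp)
    rw [b1, c1] at a1
    rw [b2, c2] at a2
    rw [b3, c3] at a3
    have key : ∀ x, 2 * (0 + GG k x) = 2 → k < x % l ∧ x % l ≤ 3 * k := by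
      intro x hx
      rw [GG, ← hlk] at hx
      split_ifs at hx with h
      · exact h
    have d1 := key _ a1
    have d2 := key _ a2
    have d3 := key _ a3
    have hrl : r < l := Nat.mod_lt _ (by omega)
    rw [Nat.mod_eq_of_lt hrl] at d1
    have e2 : (r * 2) % l = r * 2 ∨ (r * 2) % l + l = r * 2 := by
      by_cases hx : r * 2 < l
      · left; exact Nat.mod_eq_of_lt hx
      · right
        rw [show r * 2 = r * 2 - l + l by omega, Nat.add_mod_right, Nat.mod_eq_of_lt (by omega)]
    have e3 : (r * 3) % l = r * 3 ∨ (r * 3) % l + l = r * 3 ∨ (r * 3) % l + 2 * l = r * 3 := by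
      have := Nat.div_add_mod (r * 3) l
      have hq : r * 3 / l < 3 := by rw [Nat.div_lt_iff_lt_mul (by omega)]; omega
      set y := r * 3 / l
      interval_cases y <;> omega
    omega
  have hcard : Nat.card (ZMod l)ˣ = 4 * k := by
    rw [Nat.card_eq_fintype_card, ZMod.card_units, hlk]; simp
  have hord : orderOf u = 4 * k := by
    have hdvd : orderOf u ∣ 4 * k := by rw [← hcard]; exact orderOf_dvd_natCard u
    by_contra hne
    have hpow : ∀ m, orderOf u ∣ m → (p : ZMod l) ^ m = 1 := by
      intro m hm
      have := orderOf_dvd_iff_pow_eq_one.1 hm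
      have := congrArg (fun u : (ZMod l)ˣ => (u : ZMod l)) this
      simpa [hu] using this
    have h2k : ¬ orderOf u ∣ 2 * k := by
      intro hd
      have := hpow _ hd
      rw [mul_comm, pow_mul] at this
      exact hnk (sq_one_cases this)
    have hk1 : k ≠ 1 := by
      rintro rfl
      have h4 : orderOf u ∣ 2 ^ 2 := by simpa using hdvd
      obtain ⟨i, hi, hi2⟩ := (Nat.dvd_prime_pow Nat.prime_two).1 h4
      interval_cases i
      · apply h2k; rw [hi2]; simp
      · apply h2k; rw [hi2]; simp
      · apply hne; rw [hi2]; norm_num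
    have hkp := hk.resolve_left hk1
    have h4 : orderOf u ∣ 4 := by
      by_cases hd : k ∣ orderOf u
      · exfalso
        obtain ⟨s, hs⟩ := hd
        have hs4 : s ∣ 2 ^ 2 := by
          rw [hs, mul_comm 4] at hdvd
          exact Nat.dvd_of_mul_dvd_mul_left hkp.pos hdvd
        obtain ⟨i, hi, hi2⟩ := (Nat.dvd_prime_pow Nat.prime_two).1 hs4
        interval_cases i
        · apply h2k; rw [hs, hi2]; simp
        · apply h2k; rw [hs, hi2, mul_comm]; simp
        · apply hne; rw [hs, hi2, mul_comm]; norm_num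
      · exact Nat.Coprime.dvd_of_dvd_mul_right ((Nat.Prime.coprime_iff_not_dvd hkp).2 hd).symm hdvd
    have h5 := hpow 4 h4
    rw [show 4 = 2 * 2 by rfl, pow_mul] at h5
    rcases sq_one_cases h5 with h6 | h6
    · apply h2k
      rw [orderOf_dvd_iff_pow_eq_one]
      apply Units.ext
      rw [Units.val_pow_eq_pow_val, hu, pow_mul, h6]; simp
    · exact hn2 ⟨h6, hk1⟩
  have : Subgroup.zpowers u = ⊤ := by
    apply Subgroup.eq_top_of_card_eq
    rw [Nat.card_zpowers, hord, hcard]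
  intro x
  rw [this]; trivial

lemma comb_dir {k p l : ℕ} (hl : l.Prime) (hlk : l = 4 * k + 1)
    (u : (ZMod l)ˣ) (hu : (u : ZMod l) = (p : ZMod l))
    (hprim : ∀ x : (ZMod l)ˣ, x ∈ Subgroup.zpowers u) (c : ℕ) (hc : ¬ l ∣ c) :
    ∑ i ∈ Finset.range (4 * k), GG k (p ^ i * c) = 2 * k := by
  have : Fact l.Prime := ⟨hl⟩
  have hcard : Nat.card (ZMod l)ˣ = 4 * k := by
    rw [Nat.card_eq_fintype_card, ZMod.card_units, hlk]; simp
  have hord : orderOf u = 4 * k := by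
    rw [← hcard, orderOf_eq_card_of_forall_mem_zpowers hprim]
  have hc0 : (c : ZMod l) ≠ 0 := by rwa [Ne, ZMod.natCast_eq_zero_iff]
  have hmap : ∀ i ∈ Finset.range (4 * k), (p ^ i * c) % l ∈ Finset.Icc 1 (4 * k) := by
    intro i _
    have h1 : (p ^ i * c) % l < l := Nat.mod_lt _ hl.pos
    have h2 : (p ^ i * c) % l ≠ 0 := by
      intro h
      have := (ZMod.natCast_eq_zero_iff (p ^ i * c) l).2 (Nat.dvd_of_mod_eq_zero h)
      push_cast at this
      rw [← hu] at this
      exact (mul_ne_zero (pow_ne_zero i u.ne_zero) hc0) this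
    rw [Finset.mem_Icc]; omega
  have hinj : Set.InjOn (fun i => (p ^ i * c) % l) (Finset.range (4 * k) : Set ℕ) := by
    intro i hi j hj hij
    simp only [Finset.coe_range, Set.mem_Iio] at hi hj
    have h1 := (ZMod.natCast_eq_natCast_iff' _ _ _).2 hij
    push_cast at h1
    have h2 := mul_right_cancel₀ hc0 h1
    rw [← hu, ← Units.val_pow_eq_pow_val, ← Units.val_pow_eq_pow_val] at h2
    exact pow_injOn_Iio_orderOf (by rw [hord]; exact hi) (by rw [hord]; exact hj) (Units.ext h2)
  have hsurj := Finset.surjOn_of_injOn_of_card_le _ hmap hinj (by simp)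
  rw [Finset.sum_nbij (fun i => (p ^ i * c) % l) (t := Finset.Icc 1 (4 * k))
    (g := fun x => if x ∈ Finset.Ioc k (3 * k) then 1 else 0) hmap hinj hsurj]
  · rw [← Finset.sum_filter, Finset.sum_const, Finset.filter_mem_eq_inter,
      Finset.inter_eq_right.2 (by intro x; simp only [Finset.mem_Ioc, Finset.mem_Icc]; omega)]
    simp; omega
  · intro i _
    simp only [GG, Finset.mem_Ioc, hlk]

end Comb
end Cheb

namespace Cheb

set_option linter.unusedSectionVars false
set_option linter.unusedVariables false

section Conv

variable {F : Type} [Field F] [Fintype F] [DecidableEq F] (p : ℕ) [hp : Fact p.Prime] [CharP F p]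

lemma card_mod8 {p q n : ℕ} (hp4 : p % 4 = 1) (hq : q = p ^ n) : q ^ 2 % 8 = 1 := by
  have h1 : q % 4 = 1 := by rw [hq, Nat.pow_mod, hp4]; simp
  obtain ⟨z, hz⟩ : ∃ z, q = 4 * z + 1 := ⟨q / 4, by omega⟩
  have : q ^ 2 = 8 * (2 * z ^ 2 + z) + 1 := by rw [hz]; ring
  omega

lemma exists_M {l k Q : ℕ} (hl : l.Prime) (hlk : l = 4 * k + 1) (h8 : Q % 8 = 1) (hQ : 1 < Q)
    (hd : l ∣ Q - 1) : ∃ M, 0 < M ∧ Q = 4 * l * M + 1 := by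
  have h4 : 4 ∣ Q - 1 := by omega
  have hc : Nat.Coprime 4 l := by
    rw [hlk]
    simp
  obtain ⟨M, hM⟩ := hc.mul_dvd_of_dvd_of_dvd h4 hd
  refine ⟨M, ?_, by omega⟩
  rcases Nat.eq_zero_or_pos M with h | h
  · rw [h] at hM; omega
  · exact h

lemma coprime_plus {l k Q : ℕ} (hl : l.Prime) (hlk : l = 4 * k + 1) (hQ : 1 < Q)
    (hd : l ∣ Q - 1) : l.Coprime (Q + 1) := by
  rw [Nat.Prime.coprime_iff_not_dvd hl]
  intro h
  have h2 := (Nat.dvd_sub h hd)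
  rw [show Q + 1 - (Q - 1) = 2 by omega] at h2
  have := Nat.le_of_dvd (by omega) h2
  have := hl.two_le
  omega

lemma conv_minus {n l k : ℕ} (hl : l.Prime) (hlk : l = 4 * k + 1) (hp4 : p % 4 = 1) (hn : 0 < n)
    (hQ : Fintype.card F = (p ^ n) ^ 2) (hd : l ∣ Fintype.card F - 1)
    (hS : SS F l = (l - 1) * ((p ^ n : ℕ) : ℤ)) (c : ℕ) (hc : ¬ l ∣ c) :
    ∑ i ∈ Finset.range (2 * n), GG k (p ^ i * c) = n := by
  have h8 : Fintype.card F % 8 = 1 := by rw [hQ]; exact card_mod8 hp4 rfl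
  obtain ⟨M, hM, hN⟩ := exists_M hl hlk h8 Fintype.one_lt_card hd
  have hcop := coprime_plus hl hlk Fintype.one_lt_card hd
  have hex := SS_extreme p h8 hN hQ hM (by omega) hcop hS
  have hlpos := hl.pos
  set a := (4 * c + l) % (4 * l) with ha
  have hdm := Nat.div_add_mod (4 * c + l) (4 * l)
  rw [← ha] at hdm
  have halt : a < 4 * l := Nat.mod_lt _ (by omega)
  have haodd : a % 2 = 1 := by
    rw [show 4 * l * ((4 * c + l) / (4 * l)) = 2 * (2 * l * ((4 * c + l) / (4 * l))) by ring] at hdm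
    omega
  have hal : ¬ l ∣ a := by
    intro h
    have h1 : l ∣ 4 * c + l := by
      rw [← hdm]; exact dvd_add ⟨4 * ((4 * c + l) / (4 * l)), by ring⟩ h
    have h2 : l ∣ 4 * c := (Nat.dvd_add_left dvd_rfl).1 h1
    rcases (Nat.Prime.dvd_mul hl).1 h2 with h3 | h3
    · have := Nat.le_of_dvd (by omega) h3
      have : k ≠ 0 := by rintro rfl; rw [hlk] at hl; exact Nat.not_prime_one hl
      omega
    · exact hc h3
  have hj : (a - 1) / 2 ∈ EE l := by
    simp only [EE, Finset.mem_filter, Finset.mem_range]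
    rw [show 2 * ((a - 1) / 2) + 1 = a by omega]
    exact ⟨by omega, hal⟩
  have h1 := hex _ hj
  rw [show 2 * ((a - 1) / 2) + 1 = a by omega] at h1
  have h2 := JJ_val (F := F) p (f := 2 * n) (d := l) (M := M) (a := a) hN
    (by rw [← hN, hQ, ← pow_mul, mul_comm]) hM hlpos halt haodd (rc h8) (by omega)
  have h3 := JJ_eq p (n := n) _ (by omega) h2 (by rw [h1]; push_cast; rfl)
  rw [ha, rr_mod, rr_G hlk hp4] at h3
  exact h3

end Conv
end Cheb

namespace Cheb

set_option linter.unusedSectionVars false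
set_option linter.unusedVariables false

section Dir

variable {F : Type} [Field F] [Fintype F] [DecidableEq F] (p : ℕ) [hp : Fact p.Prime] [CharP F p]

lemma rr_dir {p l k : ℕ} (hl : l.Prime) (hlk : l = 4 * k + 1) (hp4 : p % 4 = 1)
    (u : (ZMod l)ˣ) (hu : (u : ZMod l) = (p : ZMod l))
    (hprim : ∀ x : (ZMod l)ˣ, x ∈ Subgroup.zpowers u) (a : ℕ) (hodd : a % 2 = 1)
    (ha : ¬ l ∣ a) : rr p (4 * k) l a = 2 * k := by
  have key : ∀ c s, 4 * c + s * l = a + 4 * l → ¬ l ∣ c := by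
    rintro c s h ⟨w, rfl⟩
    apply ha
    have h1 : l ∣ a + 4 * l := h ▸ ⟨4 * w + s, by ring⟩
    exact (Nat.dvd_add_left ⟨4, by ring⟩).1 h1
  have hm : rr p (4 * k) l a = rr p (4 * k) l (a + 4 * l) := by
    rw [← rr_mod p (4 * k) l (a + 4 * l), Nat.add_mod_right, rr_mod]
  rw [hm]
  by_cases h : a % 4 = 1
  · have e : 4 * ((a + 3 * l) / 4) + l = a + 4 * l := by omega
    rw [← e, rr_G hlk hp4, comb_dir hl hlk u hu hprim]
    exact key _ 1 (by omega)
  · have e : 4 * ((a + l) / 4) + 3 * l = a + 4 * l := by omega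
    have h1 := rr_G3 hlk hp4 (4 * k) ((a + l) / 4)
    rw [comb_dir hl hlk u hu hprim _ (key _ 3 e)] at h1
    rw [← e]; omega

lemma SS_dvd {l k : ℕ} (hl : l.Prime) (hlk : l = 4 * k + 1) (hp4 : p % 4 = 1)
    (u : (ZMod l)ˣ) (hu : (u : ZMod l) = (p : ZMod l))
    (hprim : ∀ x : (ZMod l)ˣ, x ∈ Subgroup.zpowers u) (hk : 0 < k)
    (hQ : Fintype.card F = (p ^ (2 * k)) ^ 2) (hd : l ∣ Fintype.card F - 1) :
    (p : ℤ) ^ (2 * k) ∣ SS F l := by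
  have h8 : Fintype.card F % 8 = 1 := by rw [hQ]; exact card_mod8 hp4 rfl
  obtain ⟨M, hM, hN⟩ := exists_M hl hlk h8 Fintype.one_lt_card hd
  have hcop := coprime_plus hl hlk Fintype.one_lt_card hd
  have h1 : (p : ℤ) ^ (2 * k) ∣ 2 * SS F l := by
    apply intW_dvd (F := F) p
    rw [SS_W p h8 hN hM (by omega) hcop]
    refine Finset.dvd_sum (fun j hj => ?_)
    simp only [EE, Finset.mem_filter, Finset.mem_range] at hj
    have h2 := JJ_val (F := F) p (f := 4 * k) (d := l) (M := M) (a := 2 * j + 1) hN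
      (by rw [← hN, hQ, ← pow_mul]; congr 1; ring) hM hl.pos (by omega) (by omega) (rc h8) (by omega)
    rw [rr_dir hl hlk hp4 u hu hprim _ (by omega) hj.2] at h2
    exact JJ_dvd p _ (by omega) h2 le_rfl
  refine IsCoprime.dvd_of_dvd_mul_left ?_ h1
  apply IsCoprime.pow_left
  rw [show (2 : ℤ) = ((2 : ℕ) : ℤ) by norm_num, Nat.isCoprime_iff_coprime]
  rw [Nat.coprime_primes hp.out Nat.prime_two]
  omega

lemma chi_neg_one (h8 : Fintype.card F % 8 = 1) : quadraticChar F (-1) = 1 := by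
  obtain ⟨e, h1, h2, h3⟩ := exists_e h8
  rw [← h1, map_pow, h3, one_pow]

lemma dick_neg (x : F) (n : ℕ) : (dickson 1 (1 : F) n).eval (-x) = (-1) ^ n * (dickson 1 (1 : F) n).eval x := by
  induction n using Nat.strong_induction_on with
  | _ n ih =>
    match n, ih with
    | 0, _ => simp
    | 1, _ => simp
    | n + 2, ih =>
      rw [dickson_add_two]
      simp only [eval_sub, eval_mul, eval_X, eval_C]
      rw [ih n (by omega), ih (n + 1) (by omega)]
      ring

lemma SS_even (h8 : Fintype.card F % 8 = 1) {d : ℕ} (hd : d % 2 = 1) : (2 : ℤ) ∣ SS F d := by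
  have h2 := two_ne h8
  have hodd : ∀ x : F, (dickson 1 (1 : F) d).eval (-x) = -(dickson 1 (1 : F) d).eval x := by
    intro x
    rw [dick_neg, Odd.neg_one_pow (Nat.odd_iff.2 hd)]; ring
  have h0 : (dickson 1 (1 : F) d).eval 0 = 0 := by
    have := hodd 0
    rw [neg_zero] at this
    have h3 : 2 * (dickson 1 (1 : F) d).eval 0 = 0 := by linear_combination this
    exact (mul_eq_zero.1 h3).resolve_left h2
  have h3 : ((SS F d : ℤ) : ZMod 2) = 0 := by
    rw [SS, Int.cast_sum]
    refine Finset.sum_involution (fun x _ => -x) ?_ ?_ (fun _ _ => Finset.mem_univ _) (fun _ _ => neg_neg _)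
    · intro x _
      rw [hodd, ← neg_one_mul, map_mul, chi_neg_one h8, one_mul]
      exact CharTwo.add_self_eq_zero _
    · intro x _ hx he
      apply hx
      have : x = 0 := by
        have h4 : 2 * x = 0 := by linear_combination -he
        exact (mul_eq_zero.1 h4).resolve_left h2
      rw [this, h0]; simp
  exact (ZMod.intCast_zmod_eq_zero_iff_dvd _ 2).1 h3

lemma sum_chi_zero (h8 : Fintype.card F % 8 = 1) : ∑ t : F, quadraticChar F t = 0 :=
  quadraticChar_sum_zero (rc h8)

lemma sum_chi_one_sub (h8 : Fintype.card F % 8 = 1) : ∑ t : F, quadraticChar F t * quadraticChar F (1 - t) = -1 := by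
  have h1 := jacobiSum_nontrivial_inv (χ := quadraticChar F) (quadraticChar_ne_one (rc h8))
  rw [(quadraticChar_isQuadratic F).inv, chi_neg_one h8] at h1
  exact h1

lemma BB_one_mod (h8 : Fintype.card F % 8 = 1) : BB F 1 % 8 = 6 := by
  have h2 := two_ne h8
  have hneg : ∀ x : F, quadraticChar F (-x) = quadraticChar F x := fun x => by
    rw [← neg_one_mul, map_mul, chi_neg_one h8, one_mul]
  have e1 : ∑ t : F, quadraticChar F (1 - t) = 0 := by
    rw [← sum_chi_zero h8]
    exact Fintype.sum_equiv (Equiv.subLeft 1) _ _ (fun x => rfl)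
  have e2 : ∑ t : F, quadraticChar F (1 + t) = 0 := by
    rw [← sum_chi_zero h8]
    exact Fintype.sum_equiv (Equiv.addLeft 1) _ _ (fun x => rfl)
  have e3 := sum_chi_one_sub h8
  have e4 : ∑ t : F, quadraticChar F t * quadraticChar F (1 + t) = -1 := by
    rw [← e3]
    refine Fintype.sum_equiv (Equiv.neg F) _ _ (fun x => ?_)
    simp [hneg]
  have e5 : ∑ t : F, quadraticChar F (1 - t) * quadraticChar F (1 + t) = -1 := by
    rw [← e3]
    symm
    refine Fintype.sum_equiv ((Equiv.mulLeft₀ 2 h2).trans (Equiv.subLeft 1)) _ _ (fun x => ?_)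
    simp only [Equiv.trans_apply, Equiv.mulLeft₀_apply, Equiv.subLeft_apply]
    rw [show (1 - (1 - 2 * x) : F) = 2 * x by ring, show (1 + (1 - 2 * x) : F) = 2 * (1 - x) by ring,
      map_mul, map_mul]
    have := quadraticChar_sq_one h2
    linear_combination (-(quadraticChar F x * quadraticChar F (1 - x))) * this
  have e6 : ∑ t : F, quadraticChar F t * quadraticChar F (1 - t) * quadraticChar F (1 + t) = BB F 1 := by
    rw [BB]
    refine Finset.sum_congr rfl (fun t _ => ?_)
    rw [mul_assoc, ← map_mul]; congr 2; ring
  have h3 : (8 : ℤ) ∣ ∑ t : F, (1 - quadraticChar F t) * (1 - quadraticChar F (1 - t)) * (1 - quadraticChar F (1 + t)) := by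
    refine Finset.dvd_sum (fun t _ => ?_)
    by_cases h0 : t = 0
    · simp [h0]
    by_cases h1 : 1 - t = 0
    · rw [show t = 1 by linear_combination -h1]; simp
    by_cases h1' : 1 + t = 0
    · rw [show t = -1 by linear_combination h1']; simp [chi_neg_one h8]
    rcases quadraticChar_dichotomy h0 with a | a <;> rcases quadraticChar_dichotomy h1 with b | b <;>
      rcases quadraticChar_dichotomy h1' with c | c <;> rw [a, b, c] <;> norm_num
  have h4 : ∑ t : F, (1 - quadraticChar F t) * (1 - quadraticChar F (1 - t)) * (1 - quadraticChar F (1 + t))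
      = Fintype.card F - 3 - BB F 1 := by
    have : ∀ t : F, (1 - quadraticChar F t) * (1 - quadraticChar F (1 - t)) * (1 - quadraticChar F (1 + t))
      = 1 - quadraticChar F t - quadraticChar F (1 - t) - quadraticChar F (1 + t)
        + quadraticChar F t * quadraticChar F (1 - t) + quadraticChar F t * quadraticChar F (1 + t)
        + quadraticChar F (1 - t) * quadraticChar F (1 + t)
        - quadraticChar F t * quadraticChar F (1 - t) * quadraticChar F (1 + t) := fun t => by ring
    simp only [this, Finset.sum_sub_distrib, Finset.sum_add_distrib, sum_chi_zero h8, e1, e2, e3, e4, e5, e6]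
    simp
    ring
  rw [h4] at h3
  omega

end Dir
end Cheb

namespace Cheb

set_option linter.unusedSectionVars false
set_option linter.unusedVariables false

section Gauss

lemma gauss_pow_four (d : GaussianInt) (h : d.norm % 2 = 1) :
    (d ^ 4).re % 4 = 1 ∧ (d ^ 4).im % 4 = 0 := by
  rw [Zsqrtd.norm_def] at h
  have hre : (d ^ 4).re = (d.re * d.re - d.im * d.im) ^ 2 - 4 * (d.re * d.im) ^ 2 := by
    rw [show d ^ 4 = (d * d) * (d * d) by ring]
    simp only [Zsqrtd.re_mul, Zsqrtd.im_mul]; ring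
  have him : (d ^ 4).im = 4 * ((d.re * d.re - d.im * d.im) * (d.re * d.im)) := by
    rw [show d ^ 4 = (d * d) * (d * d) by ring]
    simp only [Zsqrtd.re_mul, Zsqrtd.im_mul]; ring
  refine ⟨?_, by omega⟩
  have h1 : (d.re * d.re - d.im * d.im) % 2 = 1 := by
    have e : d.re * d.re - -1 * d.im * d.im = (d.re * d.re - d.im * d.im) + 2 * (d.im * d.im) := by ring
    rw [e] at h; omega
  obtain ⟨r, hr⟩ : ∃ r, d.re * d.re - d.im * d.im = 2 * r + 1 := ⟨(d.re * d.re - d.im * d.im) / 2, by omega⟩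
  rw [hre, hr, show (2 * r + 1) ^ 2 = 4 * (r * r + r) + 1 by ring]
  omega

lemma gauss_pow_fourk (d : GaussianInt) (h : d.norm % 2 = 1) (k : ℕ) :
    (d ^ (4 * k)).re % 4 = 1 ∧ (d ^ (4 * k)).im % 4 = 0 := by
  obtain ⟨h1, h2⟩ := gauss_pow_four d h
  rw [pow_mul]
  generalize d ^ 4 = e at *
  induction k with
  | zero => simp
  | succ k ih =>
    obtain ⟨h3, h4⟩ := ih
    rw [pow_succ, Zsqrtd.re_mul, Zsqrtd.im_mul]
    obtain ⟨a, ha⟩ : ∃ a, e.re = 4 * a + 1 := ⟨e.re / 4, by omega⟩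
    obtain ⟨b, hb⟩ : ∃ b, e.im = 4 * b := ⟨e.im / 4, by omega⟩
    obtain ⟨a', ha'⟩ : ∃ a, (e ^ k).re = 4 * a + 1 := ⟨(e ^ k).re / 4, by omega⟩
    obtain ⟨b', hb'⟩ : ∃ b, (e ^ k).im = 4 * b := ⟨(e ^ k).im / 4, by omega⟩
    rw [ha, hb, ha', hb']
    constructor
    · rw [show (4 * a' + 1) * (4 * a + 1) + -1 * (4 * b') * (4 * b) = 4 * (4 * a' * a + a' + a - 4 * b' * b) + 1 by ring]
      omega
    · rw [show (4 * a' + 1) * (4 * b) + 4 * b' * (4 * a + 1) = 4 * ((4 * a' + 1) * b + b' * (4 * a + 1)) by ring]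
      omega

lemma gauss_arith {Z : GaussianInt} {p k l : ℕ} (hp : p.Prime) (hp2 : p % 2 = 1) (hl : l.Prime)
    (hlk : l = 4 * k + 1) (hk : 0 < k) (hpl : ¬ l ∣ p)
    (hn : Z.norm = (p : ℤ) ^ (4 * k)) (hcop : ¬ (p : ℤ) ∣ 2 * Z.re) (hZ : Z.re % 4 = 3) :
    ((2 * Z.re : ℤ) : ZMod l) = -2 := by
  have : Fact l.Prime := ⟨hl⟩
  have hadd : Z + star Z = ((2 * Z.re : ℤ) : GaussianInt) := by
    ext
    · simp; ring
    · simp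
  have hmul : Z * star Z = (p : GaussianInt) ^ (4 * k) := by
    rw [← Zsqrtd.norm_eq_mul_conj, hn]; push_cast; rfl
  have h1 : IsCoprime (2 * Z.re : ℤ) ((p : ℤ) ^ (4 * k)) := by
    apply IsCoprime.pow_right
    exact ((Prime.coprime_iff_not_dvd (Nat.prime_iff_prime_int.1 hp)).2 hcop).symm
  have h2 : IsCoprime (Z + star Z) (Z * star Z) := by
    rw [hadd, hmul]
    have := h1.map (Int.castRingHom GaussianInt)
    simpa using this
  have h3 : IsCoprime Z (star Z) := by
    have h4 := h2.of_mul_right_left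
    have h5 : IsCoprime (star Z + Z * 1) Z := by rwa [mul_one, add_comm]
    exact h5.of_add_mul_left_left.symm
  obtain ⟨d, u, hdu⟩ := exists_associated_pow_of_mul_eq_pow' h3 hmul
  have hnu : (u : GaussianInt).norm = 1 := by
    have h6 := Zsqrtd.norm_eq_one_iff.2 u.isUnit
    have h7 : 0 ≤ (u : GaussianInt).norm := GaussianInt.norm_nonneg _
    omega
  have hnd : d.norm ^ (4 * k) = (p : ℤ) ^ (4 * k) := by
    rw [← hn, ← hdu, Zsqrtd.norm_mul, hnu, mul_one]
    exact (map_pow (Zsqrtd.normMonoidHom (d := -1)) d (4 * k)).symm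
  have hnd' : d.norm = p := by
    have h7 : 0 ≤ d.norm := GaussianInt.norm_nonneg _
    exact (pow_left_inj₀ h7 (by positivity) (by omega)).1 hnd
  obtain ⟨h6, h7⟩ := gauss_pow_fourk d (by omega) k
  have hu1 : (u : GaussianInt).re = -1 ∧ (u : GaussianInt).im = 0 := by
    have h8 := congrArg Zsqrtd.re hdu
    rw [Zsqrtd.re_mul] at h8
    rw [Zsqrtd.norm_def] at hnu
    generalize (u : GaussianInt).re = a at *
    generalize (u : GaussianInt).im = b at *
    have ha : a ≤ 1 := by nlinarith [mul_self_nonneg b]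
    have ha' : -1 ≤ a := by nlinarith [mul_self_nonneg b]
    have e1 : (d ^ (4 * k)).re = 4 * ((d ^ (4 * k)).re / 4) + 1 := by omega
    have e2 : (d ^ (4 * k)).im = 4 * ((d ^ (4 * k)).im / 4) := by omega
    generalize (d ^ (4 * k)).re / 4 = x at *
    generalize (d ^ (4 * k)).im / 4 = y at *
    rw [e1, e2] at h8
    have h9 : 4 * (x * a - y * b) + a = Z.re := by rw [← h8]; ring
    have h10 : a = -1 := by omega
    refine ⟨h10, ?_⟩
    rw [h10] at hnu
    nlinarith
  have hu2 : (u : GaussianInt) = -1 := by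
    ext
    · rw [hu1.1]; simp
    · rw [hu1.2]; simp
  have hZd : Z = -d ^ (4 * k) := by rw [← hdu, hu2]; ring
  obtain ⟨s, hs⟩ := ZMod.exists_sq_eq_neg_one_iff.2 (show l % 4 ≠ 3 by omega)
  let θ : GaussianInt →+* ZMod l := Zsqrtd.lift ⟨s, by rw [← hs]; simp⟩
  have hp0 : (p : ZMod l) ≠ 0 := by
    rw [Ne, ZMod.natCast_eq_zero_iff]; exact hpl
  have hθ : θ d * θ (star d) = p := by
    rw [← map_mul, ← Zsqrtd.norm_eq_mul_conj, hnd']; simp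
  have key : ∀ e : GaussianInt, θ e ≠ 0 → θ e ^ (4 * k) = 1 := by
    intro e he
    have := ZMod.pow_card_sub_one_eq_one he
    rwa [show l - 1 = 4 * k by omega] at this
  have hsum : θ (Z + star Z) = -2 := by
    rw [hZd, star_neg, star_pow, map_add, map_neg, map_neg, map_pow, map_pow, key d, key (star d)]
    · ring
    · intro h; rw [h, mul_zero] at hθ; exact hp0 hθ.symm
    · intro h; rw [h, zero_mul] at hθ; exact hp0 hθ.symm
  rw [hadd, map_intCast] at hsum
  exact hsum

end Gauss
section DirB

variable {F : Type} [Field F] [Fintype F] [DecidableEq F] (p : ℕ) [hp : Fact p.Prime] [CharP F p]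

lemma exists_Z (h8 : Fintype.card F % 8 = 1) {M : ℕ} (hN : Fintype.card F = 4 * 1 * M + 1) (hM : 0 < M) :
    ∃ (ρ : GaussianInt →+* WittVector p F) (Z : GaussianInt),
      ρ Z = JJ p M 1 ∧ ρ (star Z) = JJ p M 3 := by
  obtain ⟨e, he, he0, -⟩ := exists_e h8
  have hω : th p e * th p e = ((-1 : ℤ) : WittVector p F) := by
    rw [← map_mul, ← sq, he, th_neg_one p (rc h8)]; simp
  let ρ : GaussianInt →+* WittVector p F := Zsqrtd.lift ⟨th p e, hω⟩
  have hρ : ∀ a b : ℤ, ρ ⟨a, b⟩ = a + b * th p e := fun a b => Zsqrtd.lift_apply_apply _ _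
  have hz : ∀ x : F, ∃ z : GaussianInt, ρ z = (th p ^ (1 * M)) x ∧ ρ (star z) = (th p ^ (3 * M)) x := by
    intro x
    by_cases hx : x = 0
    · exact ⟨0, by rw [hx, MulChar.map_zero, map_zero], by rw [hx, MulChar.map_zero, star_zero, map_zero]⟩
    have h1 : (th p ^ (1 * M)) x = th p (x ^ M) := by
      rw [MulChar.pow_apply' _ (by omega), map_pow, one_mul]
    have h3 : (th p ^ (3 * M)) x = th p (x ^ M) ^ 3 := by
      rw [MulChar.pow_apply' _ (by omega), map_pow, ← pow_mul]; congr 1; ring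
    rw [h1, h3]
    have h4 : (x ^ M) ^ 4 = 1 := by
      rw [← pow_mul, show M * 4 = Fintype.card F - 1 by omega]
      exact FiniteField.pow_card_sub_one_eq_one x hx
    generalize x ^ M = y at *
    have h5 : y = 1 ∨ y = -1 ∨ y = e ∨ y = -e := by
      have h6 : (y - 1) * ((y + 1) * ((y - e) * (y + e))) = 0 := by
        linear_combination h4 + (1 - y ^ 2) * he
      rcases mul_eq_zero.1 h6 with h | h
      · left; linear_combination h
      rcases mul_eq_zero.1 h with h | h
      · right; left; linear_combination h
      rcases mul_eq_zero.1 h with h | h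
      · right; right; left; linear_combination h
      · right; right; right; linear_combination h
    have hm : th p (-e) = - th p e := by
      rw [← neg_one_mul, map_mul, th_neg_one p (rc h8), neg_one_mul]
    have hω' : th p e * th p e = -1 := by rw [hω]; simp
    rcases h5 with rfl | rfl | rfl | rfl
    · refine ⟨⟨1, 0⟩, ?_, ?_⟩ <;> simp [hρ]
    · refine ⟨⟨-1, 0⟩, ?_, ?_⟩ <;> simp [hρ, th_neg_one p (rc h8)]
      ring
    · refine ⟨⟨0, 1⟩, ?_, ?_⟩ <;> simp [hρ]
      linear_combination (- th p y) * hω'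
    · refine ⟨⟨0, -1⟩, ?_, ?_⟩ <;> simp [hρ, hm]
      linear_combination (th p e) * hω'
  choose z hz1 hz3 using hz
  refine ⟨ρ, ∑ x : F, z x * ((quadraticChar F (1 - x) : ℤ) : GaussianInt), ?_, ?_⟩
  · rw [map_sum, JJ, jacobiSum]
    refine Finset.sum_congr rfl (fun x _ => ?_)
    rw [map_mul, hz1, map_intCast, chiW_apply]
  · rw [star_sum, map_sum, JJ, jacobiSum]
    refine Finset.sum_congr rfl (fun x _ => ?_)
    rw [star_mul', map_mul, hz3, star_intCast, map_intCast, chiW_apply]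

lemma rho_norm (ρ : GaussianInt →+* ℂ) (Z : GaussianInt) : ‖ρ Z‖ ^ 2 = (Z.norm : ℝ) := by
  obtain ⟨⟨w, hw⟩, rfl⟩ := Zsqrtd.lift.surjective ρ
  rw [Zsqrtd.lift_apply_apply, Complex.sq_norm, Zsqrtd.norm_def]
  have h : w = Complex.I ∨ w = -Complex.I := by
    apply mul_self_eq_mul_self_iff.1
    rw [hw, Complex.I_mul_I]; simp
  rcases h with rfl | rfl <;> simp [Complex.normSq_apply]

lemma BB_one_l {l k : ℕ} (hl : l.Prime) (hlk : l = 4 * k + 1) (hp4 : p % 4 = 1) (hk : 0 < k)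
    (hpl : ¬ l ∣ p) (hQ : Fintype.card F = (p ^ (2 * k)) ^ 2) :
    ((BB F 1 : ℤ) : ZMod l) = -2 := by
  have h8 : Fintype.card F % 8 = 1 := by rw [hQ]; exact card_mod8 hp4 rfl
  obtain ⟨M, hN⟩ : ∃ M, Fintype.card F = 4 * 1 * M + 1 := ⟨Fintype.card F / 4, by omega⟩
  have hM : 0 < M := by
    have := Fintype.one_lt_card (α := F)
    omega
  have hQ' : Fintype.card F = p ^ (4 * k) := by rw [hQ, ← pow_mul]; congr 1; ring
  obtain ⟨ρ, Z, hZ1, hZ3⟩ := exists_Z p h8 hN hM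
  have hB := BB_W p hN (by omega) hM (rc h8)
  rw [show 2 * 1 = 2 from rfl, Finset.sum_range_succ, Finset.sum_range_one] at hB
  have hB' : (BB F 1 : WittVector p F) = JJ p M 1 + JJ p M 3 := hB
  have hadd : Z + star Z = ((2 * Z.re : ℤ) : GaussianInt) := by
    ext
    · simp; ring
    · simp
  have hBZ : BB F 1 = 2 * Z.re := by
    have h1 : ((BB F 1 : ℤ) : WittVector p F) = ((2 * Z.re : ℤ) : WittVector p F) := by
      rw [hB', ← hZ1, ← hZ3, ← map_add, hadd, map_intCast]
    exact_mod_cast h1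
  have hmod := BB_one_mod h8
  obtain ⟨ι, hι⟩ := exists_embed (F := F) p
  have hnorm : Z.norm = (p : ℤ) ^ (4 * k) := by
    have h1 := JJ_norm p hN hM (by omega) (a := 1) (by omega) (by omega) (rc h8) ι hι
    have h2 := rho_norm (ι.comp ρ) Z
    rw [RingHom.comp_apply, hZ1, h1, hQ'] at h2
    exact_mod_cast h2.symm
  have hpi : ∀ i, p ^ i % 4 = 1 := fun i => by rw [Nat.pow_mod, hp4]; simp
  have hr1 : rr p (4 * k) 1 1 = 0 := by
    rw [rr, Finset.card_eq_zero, Finset.filter_eq_empty_iff]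
    intro i _
    rw [mul_one, mul_one, mul_one, hpi]; omega
  have hr3 : rr p (4 * k) 1 3 = 4 * k := by
    rw [rr, Finset.filter_true_of_mem, Finset.card_range]
    intro i _
    have := hpi i
    omega
  have hv1 := JJ_val (F := F) p (f := 4 * k) (d := 1) (M := M) (a := 1) hN (hQ'.symm.trans hN) hM
    (by omega) (by omega) (by omega) (rc h8) (by omega)
  have hv3 := JJ_val (F := F) p (f := 4 * k) (d := 1) (M := M) (a := 3) hN (hQ'.symm.trans hN) hM
    (by omega) (by omega) (by omega) (rc h8) (by omega)
  rw [hr3] at hv3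
  have hd3 : (p : WittVector p F) ∣ JJ p M 3 := by
    have := JJ_dvd p (n := 1) _ (by omega) hv3 (by omega)
    rwa [pow_one] at this
  obtain ⟨u, hu⟩ := hv1
  rw [hr1, mul_zero, pow_zero, mul_one] at hu
  have hndvd : ¬ (p : ℤ) ∣ BB F 1 := by
    rintro ⟨w, hw⟩
    have h1 : (p : WittVector p F) ∣ JJ p M 1 := by
      have h2 : JJ p M 1 = ((BB F 1 : ℤ) : WittVector p F) - JJ p M 3 := by rw [hB']; ring
      rw [h2, hw]
      push_cast
      exact dvd_sub (dvd_mul_right _ _) hd3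
    have h3 : (p : WittVector p F) ∣ (u : WittVector p F) := by
      rw [← hu]
      exact dvd_pow h1 (by omega)
    exact (primeW (F := F) p).not_isUnit (isUnit_of_dvd_unit h3 u.isUnit)
  rw [hBZ] at hndvd ⊢
  exact gauss_arith hp.out (by omega) hl hlk hk hpl hnorm hndvd (by omega)

lemma dir_main {l k : ℕ} (hl : l.Prime) (hlk : l = 4 * k + 1) (hp4 : p % 4 = 1) (hk : 0 < k)
    (hpl : ¬ l ∣ p) (hQ : Fintype.card F = (p ^ (2 * k)) ^ 2)
    (u : (ZMod l)ˣ) (hu : (u : ZMod l) = (p : ZMod l))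
    (hprim : ∀ x : (ZMod l)ˣ, x ∈ Subgroup.zpowers u) :
    SS F l = (l - 1) * ((p ^ (2 * k) : ℕ) : ℤ) := by
  have : Fact l.Prime := ⟨hl⟩
  have h8 : Fintype.card F % 8 = 1 := by rw [hQ]; exact card_mod8 hp4 rfl
  have ho : orderOf u = 4 * k := by
    rw [orderOf_eq_card_of_forall_mem_zpowers hprim, Nat.card_eq_fintype_card, ZMod.card_units, hlk]
    simp
  have hsq : ((p : ZMod l) ^ (2 * k)) ^ 2 = 1 := by
    rw [← hu, ← pow_mul, show 2 * k * 2 = orderOf u by rw [ho]; ring]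
    rw [← Units.val_pow_eq_pow_val, pow_orderOf_eq_one, Units.val_one]
  have hpm : (p : ZMod l) ^ (2 * k) = -1 := by
    rcases sq_one_cases hsq with h | h
    · exfalso
      rw [← hu] at h
      have h1 : u ^ (2 * k) = 1 := Units.ext (by simpa using h)
      have := Nat.le_of_dvd (by omega) (orderOf_dvd_of_pow_eq_one h1)
      omega
    · exact h
  have hd : l ∣ Fintype.card F - 1 := by
    have h1 := Fintype.one_lt_card (α := F)
    rw [← ZMod.natCast_eq_zero_iff, Nat.cast_sub (by omega), hQ]
    push_cast
    rw [hsq, sub_self]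
  obtain ⟨M, hM, hN⟩ := exists_M hl hlk h8 Fintype.one_lt_card hd
  have hcop := coprime_plus hl hlk Fintype.one_lt_card hd
  have hb := SS_bound p h8 hN hQ hM (by omega) hcop
  obtain ⟨m, hm⟩ := SS_dvd p hl hlk hp4 u hu hprim hk hQ hd
  have hev := SS_even h8 (d := l) (by omega)
  have hS := SS_eq h8 (d := l) (by omega) hcop
  have hBl := BB_dvd hN hl.pos hM (rc h8)
  have hB1 := BB_one_l (F := F) p hl hlk hp4 hk hpl hQ
  have hq0 : (0 : ℤ) < (p : ℤ) ^ (2 * k) := by have := hp.out.pos; positivity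
  have hmod : ((m + 1 : ℤ) : ZMod l) = 0 := by
    have h1 : ((2 * SS F l : ℤ) : ZMod l) = 2 := by
      rw [hS, Int.cast_sub, hB1, (ZMod.intCast_zmod_eq_zero_iff_dvd _ l).2 hBl]; ring
    rw [hm] at h1
    push_cast at h1
    rw [hpm] at h1
    have h2 : (2 : ZMod l) ≠ 0 := by
      intro h
      have h3 : ((2 : ℕ) : ZMod l) = 0 := by exact_mod_cast h
      rw [ZMod.natCast_eq_zero_iff] at h3
      have := Nat.le_of_dvd (by omega) h3
      omega
    have h3 : (2 : ZMod l) * ((m + 1 : ℤ) : ZMod l) = 0 := by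
      push_cast; linear_combination -h1
    exact (mul_eq_zero.1 h3).resolve_left h2
  have hmod' := (ZMod.intCast_zmod_eq_zero_iff_dvd _ l).1 hmod
  have hmb : |m| ≤ l - 1 := by
    rw [hm, abs_mul, abs_mul, abs_of_pos hq0] at hb
    push_cast at hb
    have h1 : |m| * (p : ℤ) ^ (2 * k) ≤ (l - 1) * (p : ℤ) ^ (2 * k) := by
      rw [abs_of_pos (by norm_num : (0 : ℤ) < 2)] at hb
      linarith
    exact le_of_mul_le_mul_right h1 hq0
  rw [abs_le] at hmb
  have hmev : m % 2 = 0 := by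
    rw [hm] at hev
    have hpo : ¬ (2 : ℤ) ∣ (p : ℤ) ^ (2 * k) := by
      intro h
      have := Int.prime_two.dvd_of_dvd_pow h
      omega
    have := (Int.prime_two.dvd_or_dvd hev).resolve_left hpo
    omega
  have hfin : m = l - 1 := by
    obtain ⟨w, hw⟩ := hmod'
    have hl0 := hl.two_le
    have hw2 : w < 2 := by
      by_contra h; push Not at h
      have : (l : ℤ) * 2 ≤ l * w := mul_le_mul_of_nonneg_left h (by positivity)
      omega
    have hw0 : -1 < w := by
      by_contra h; push Not at h
      have : (l : ℤ) * w ≤ l * (-1) := mul_le_mul_of_nonneg_left h (by positivity)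
      omega
    have : w = 0 ∨ w = 1 := by omega
    rcases this with rfl | rfl <;> omega
  rw [hm, hfin]; push_cast; ring

end DirB
end Cheb

namespace Cheb

set_option linter.unusedSectionVars false
set_option linter.unusedVariables false

section GPoly

/-- `dickson 1 1 (2 m + 1) = X * GP m (X ^ 2)` -/
noncomputable def GP (K : Type) [Field K] : ℕ → K[X]
  | 0 => 1
  | 1 => X - C 3
  | m + 2 => (X - C 2) * GP K (m + 1) - GP K m

variable {K : Type} [Field K]

lemma GP_monic_aux (m : ℕ) : ((GP K m).Monic ∧ (GP K m).natDegree = m) ∧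
    ((GP K (m + 1)).Monic ∧ (GP K (m + 1)).natDegree = m + 1) := by
  induction m with
  | zero =>
    refine ⟨⟨?_, ?_⟩, ?_, ?_⟩
    · exact monic_one
    · exact natDegree_one
    · exact monic_X_sub_C 3
    · exact natDegree_X_sub_C 3
  | succ m ih =>
    obtain ⟨⟨h1, h2⟩, h3, h4⟩ := ih
    refine ⟨⟨h3, h4⟩, ?_⟩
    have h5 : ((X - C 2) * GP K (m + 1)).Monic := (monic_X_sub_C 2).mul h3
    have h6 : ((X - C 2) * GP K (m + 1)).natDegree = m + 2 := by
      rw [(monic_X_sub_C 2).natDegree_mul h3, natDegree_X_sub_C, h4]; ring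
    have h7 : (GP K m).natDegree < ((X - C 2) * GP K (m + 1)).natDegree := by omega
    have h8 : (GP K m).degree < ((X - C 2) * GP K (m + 1)).degree :=
      degree_lt_degree h7
    have e : GP K (m + 1 + 1) = (X - C 2) * GP K (m + 1) - GP K m := by rw [GP]
    rw [e]
    refine ⟨h5.sub_of_left h8, ?_⟩
    rw [natDegree_sub_eq_left_of_natDegree_lt h7, h6]

lemma GP_eval_aux (x : K) (m : ℕ) :
    x * (GP K m).eval (x ^ 2) = (dickson 1 (1 : K) (2 * m + 1)).eval x ∧
    x * (GP K (m + 1)).eval (x ^ 2) = (dickson 1 (1 : K) (2 * m + 3)).eval x := by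
  have hd : ∀ n, (dickson 1 (1 : K) (n + 2)).eval x =
      x * (dickson 1 (1 : K) (n + 1)).eval x - (dickson 1 (1 : K) n).eval x := by
    intro n
    rw [dickson_add_two]; simp
  induction m with
  | zero =>
    constructor
    · simp [GP]
    · have h1 := hd 1
      have h0 := hd 0
      have h2 : (dickson 1 (1 : K) 1).eval x = x := by simp
      have h3 : (dickson 1 (1 : K) 0).eval x = 2 := by simp; norm_num
      have e : GP K (0 + 1) = X - C 3 := by rw [GP]
      rw [e]
      simp only [eval_sub, eval_X, eval_C]
      rw [show 1 + 2 = 3 from rfl, show 1 + 1 = 2 from rfl] at h1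
      rw [show 0 + 2 = 2 from rfl, show 0 + 1 = 1 from rfl] at h0
      rw [show 2 * 0 + 3 = 3 from rfl, h1, h0, h2, h3]; ring
  | succ m ih =>
    refine ⟨ih.2, ?_⟩
    have e : GP K (m + 1 + 1) = (X - C 2) * GP K (m + 1) - GP K m := by rw [GP]
    rw [e]
    simp only [eval_sub, eval_mul, eval_X, eval_C]
    have a1 := hd (2 * m + 3)
    have a2 := hd (2 * m + 2)
    have a3 := hd (2 * m + 1)
    rw [show 2 * (m + 1) + 3 = 2 * m + 3 + 2 by ring, a1]
    rw [show 2 * m + 3 + 1 = 2 * m + 2 + 2 by ring, a2]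
    rw [show 2 * m + 1 + 2 = 2 * m + 3 by ring, show 2 * m + 1 + 1 = 2 * m + 2 by ring] at a3
    rw [show 2 * m + 2 + 1 = 2 * m + 3 by ring]
    linear_combination (x ^ 2 - 2) * ih.2 - ih.1 - a3

lemma GP_zero_aux (m : ℕ) : (GP K m).eval 0 = (-1) ^ m * (2 * m + 1) ∧
    (GP K (m + 1)).eval 0 = (-1) ^ (m + 1) * (2 * m + 3) := by
  induction m with
  | zero =>
    constructor
    · simp [GP]
    · have e : GP K (0 + 1) = X - C 3 := by rw [GP]
      rw [e]; simp
  | succ m ih =>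
    refine ⟨by rw [ih.2]; push_cast; ring, ?_⟩
    have e : GP K (m + 1 + 1) = (X - C 2) * GP K (m + 1) - GP K m := by rw [GP]
    rw [e]
    simp only [eval_sub, eval_mul, eval_X, eval_C]
    rw [ih.1, ih.2]; push_cast; ring

lemma GP_map_aux {F : Type} [Field F] [Algebra F K] (m : ℕ) :
    (GP F m).map (algebraMap F K) = GP K m ∧ (GP F (m + 1)).map (algebraMap F K) = GP K (m + 1) := by
  induction m with
  | zero =>
    constructor
    · simp [GP]
    · have e : GP F (0 + 1) = X - C 3 := by rw [GP]
      have e' : GP K (0 + 1) = X - C 3 := by rw [GP]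
      rw [e, e']; simp [map_ofNat (algebraMap F K) 3]
  | succ m ih =>
    refine ⟨ih.2, ?_⟩
    have e : GP F (m + 1 + 1) = (X - C 2) * GP F (m + 1) - GP F m := by rw [GP]
    have e' : GP K (m + 1 + 1) = (X - C 2) * GP K (m + 1) - GP K m := by rw [GP]
    rw [e, e', Polynomial.map_sub, Polynomial.map_mul, ih.1, ih.2]
    simp [map_ofNat (algebraMap F K) 2]

lemma signs_mod {ι : Type*} (s : Finset ι) (ε : ι → ℤ) (h : ∀ i ∈ s, ε i = 1 ∨ ε i = -1) :
    (4 : ℤ) ∣ ∑ i ∈ s, ε i - (s.card - 1 + ∏ i ∈ s, ε i) ∧ (∏ i ∈ s, ε i = 1 ∨ ∏ i ∈ s, ε i = -1) := by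
  classical
  induction s using Finset.induction_on with
  | empty => simp
  | insert a s ha ih =>
    obtain ⟨h1, h2⟩ := ih (fun i hi => h i (Finset.mem_insert_of_mem hi))
    rw [Finset.sum_insert ha, Finset.prod_insert ha, Finset.card_insert_of_notMem ha]
    push_cast
    rcases h a (Finset.mem_insert_self _ _) with h3 | h3 <;> rcases h2 with h4 | h4 <;> rw [h3, h4] <;>
      rw [h4] at h1 <;> refine ⟨?_, by norm_num⟩ <;> omega

end GPoly

section Plus

variable {F : Type} [Field F] [Fintype F] [DecidableEq F] (p : ℕ) [hp : Fact p.Prime] [CharP F p]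

lemma root_pow {K : Type} [Field K] [IsAlgClosed K] [CharP K p] (h2 : (2 : K) ≠ 0) {m l Q h f w : ℕ}
    (hQ : Q = p ^ f) (hQh : Q = 2 * h + 1)
    (hlm : l = 2 * m + 1) (hl0 : (l : K) ≠ 0) (hw : Q + 1 = 2 * l * w) (hwo : Odd w)
    (a : K) (ha : (GP K m).eval a = 0) : a ^ h = -1 := by
  obtain ⟨r, rfl⟩ := IsAlgClosed.exists_pow_nat_eq a (n := 2) (by norm_num)
  obtain ⟨s, hs⟩ := IsAlgClosed.exists_pow_nat_eq (r ^ 2 - 4) (n := 2) (by norm_num)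
  have hq : ((s + r) / 2) * ((r - s) / 2) = 1 := by
    have h4 : (4 : K) ≠ 0 := by
      rw [show (4 : K) = 2 * 2 by norm_num]; exact mul_ne_zero h2 h2
    field_simp; linear_combination -hs
  obtain ⟨t, ht, hr⟩ : ∃ t : K, t ≠ 0 ∧ r = t + t⁻¹ := by
    refine ⟨(s + r) / 2, left_ne_zero_of_mul_eq_one hq, ?_⟩
    rw [inv_eq_of_mul_eq_one_right hq]; field_simp; ring
  have hr0 : r ≠ 0 := by
    rintro h0
    rw [h0] at ha
    rw [zero_pow (by norm_num), (GP_zero_aux m).1] at ha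
    rcases mul_eq_zero.1 ha with h | h
    · exact pow_ne_zero _ (neg_ne_zero.2 one_ne_zero) h
    · apply hl0; rw [hlm]; push_cast; exact h
  have h1 := (GP_eval_aux r m).1
  rw [ha, mul_zero, hr, dickson_one_one_eval_add_inv _ _ (mul_inv_cancel₀ ht), ← hlm, inv_pow] at h1
  have htl : t ^ (2 * l) = -1 := by
    have h3 : t ^ l ≠ 0 := pow_ne_zero _ ht
    rw [mul_comm, pow_mul]
    field_simp at h1
    linear_combination -h1
  have htQ : t ^ Q * t = -1 := by
    rw [← pow_succ, hw, pow_mul, htl, hwo.neg_one_pow]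
  have hrQ : r ^ Q = -r := by
    have h5 : t ^ Q = -t⁻¹ := by
      field_simp; exact htQ
    rw [hr, hQ, add_pow_char_pow, ← hQ, inv_pow, h5, inv_neg, inv_inv]; ring
  rw [hQh, pow_succ] at hrQ
  rw [← pow_mul]
  apply mul_right_cancel₀ hr0
  rw [hrQ]; ring

lemma prim_prod {K : Type*} [Field K] {ζ : K} {h : ℕ} (hh : 0 < h) (hζ : IsPrimitiveRoot ζ h) (a : K) :
    ∏ i ∈ Finset.range h, (a - ζ ^ i) = a ^ h - 1 := by
  classical
  have h1 : nthRootsFinset h (1 : K) = (Finset.range h).image (fun i => ζ ^ i) := by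
    symm
    apply Finset.eq_of_subset_of_card_le
    · intro x hx
      obtain ⟨i, _, rfl⟩ := Finset.mem_image.1 hx
      rw [mem_nthRootsFinset hh, ← pow_mul, mul_comm, pow_mul, hζ.pow_eq_one, one_pow]
    · rw [hζ.card_nthRootsFinset, Finset.card_image_of_injOn hζ.injOn_pow, Finset.card_range]
  have h2 := congrArg (eval a) (X_pow_sub_one_eq_prod hh hζ)
  rw [h1, Finset.prod_image hζ.injOn_pow, eval_prod] at h2
  simpa using h2.symm

lemma prod_GP {m l h f w : ℕ} (h2 : (2 : F) ≠ 0) (hQ : Fintype.card F = p ^ f)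
    (hQh : Fintype.card F = 2 * h + 1) (hh : 0 < h) (hhe : Even h)
    (hlm : l = 2 * m + 1) (hl0 : (l : F) ≠ 0) (hw : Fintype.card F + 1 = 2 * l * w) (hwo : Odd w)
    {ζ : F} (hζ : IsPrimitiveRoot ζ h) :
    ∏ i ∈ Finset.range h, (GP F m).eval (ζ ^ i) = (-2) ^ m := by
  let K := AlgebraicClosure F
  have hinj : Function.Injective (algebraMap F K) := (algebraMap F K).injective
  have : CharP K p := charP_of_injective_algebraMap hinj p
  have h2' : (2 : K) ≠ 0 := by
    have := (map_ne_zero (algebraMap F K)).2 h2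
    rwa [map_ofNat] at this
  have hl0' : (l : K) ≠ 0 := by
    have := (map_ne_zero (algebraMap F K)).2 hl0
    rwa [map_natCast] at this
  have hmon := (GP_monic_aux (K := K) m).1
  have hsp : (GP K m).Splits := IsAlgClosed.splits _
  have hζ' : IsPrimitiveRoot (algebraMap F K ζ) h := hζ.map_of_injective hinj
  apply hinj
  rw [map_prod, map_pow, map_neg, map_ofNat]
  have e1 : ∀ i ∈ Finset.range h, algebraMap F K ((GP F m).eval (ζ ^ i)) =
      ((GP K m).roots.map (fun a => (algebraMap F K ζ) ^ i - a)).prod := by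
    intro i _
    rw [← eval_map_apply, (GP_map_aux m).1, map_pow, ← hsp.eval_eq_prod_roots_of_monic hmon.1]
  rw [Finset.prod_congr rfl e1, ← Multiset.prod_map_prod]
  have e2 : ∀ a ∈ (GP K m).roots, ∏ i ∈ Finset.range h, ((algebraMap F K ζ) ^ i - a) = -2 := by
    intro a ha
    have h3 := root_pow p h2' hQ hQh hlm hl0' hw hwo a (isRoot_of_mem_roots ha)
    have h4 := prim_prod hh hζ' a
    rw [h3] at h4
    have h5 : ∏ i ∈ Finset.range h, ((algebraMap F K ζ) ^ i - a) =
        (-1) ^ h * ∏ i ∈ Finset.range h, (a - (algebraMap F K ζ) ^ i) := by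
      rw [← Finset.card_range h, ← Finset.prod_const, Finset.card_range, ← Finset.prod_mul_distrib]
      exact Finset.prod_congr rfl (fun i _ => by ring)
    rw [h5, h4, hhe.neg_one_pow]; ring
  rw [Multiset.map_congr rfl e2, Multiset.map_const', Multiset.prod_replicate,
    ← hsp.natDegree_eq_card_roots, hmon.2]

lemma SS_plus {l k : ℕ} (hl : l.Prime) (hlk : l = 4 * k + 1) (hp4 : p % 4 = 1) {f : ℕ}
    (hQ : Fintype.card F = p ^ f) (h8 : Fintype.card F % 8 = 1)
    (hpl : ¬ p ∣ l) (hd : l ∣ Fintype.card F + 1) : (8 : ℤ) ∣ SS F l := by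
  have h2 := two_ne h8
  obtain ⟨h, hQh⟩ : ∃ h, Fintype.card F = 2 * h + 1 := ⟨Fintype.card F / 2, by omega⟩
  have hh : 0 < h := by
    have := Fintype.one_lt_card (α := F)
    omega
  have hh4 : h % 4 = 0 := by omega
  obtain ⟨w', hw'⟩ := hd
  obtain ⟨w, rfl⟩ : ∃ w, w' = 2 * w := by
    have : 2 ∣ l * w' := by omega
    rcases (Nat.Prime.dvd_mul Nat.prime_two).1 this with h | h
    · omega
    · exact h
  have hw : Fintype.card F + 1 = 2 * l * w := by rw [hw']; ring
  have hwo : Odd w := by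
    by_contra hne
    rw [Nat.not_odd_iff_even] at hne
    obtain ⟨v, rfl⟩ := hne
    have : Fintype.card F + 1 = 4 * (l * v) := by rw [hw]; ring
    omega
  have hl0 : (l : F) ≠ 0 := by
    rw [Ne, CharP.cast_eq_zero_iff F p]; exact hpl
  obtain ⟨γ, hγ, ho⟩ := exists_gen hQh
  have hg : IsPrimitiveRoot γ (2 * h) := by rw [IsPrimitiveRoot.iff_orderOf, ho]
  have hgF : IsPrimitiveRoot (γ : F) (2 * h) :=
    hg.map_of_injective (f := Units.coeHom F) Units.val_injective
  have hζ : IsPrimitiveRoot ((γ : F) ^ 2) h := hgF.pow (by omega) rfl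
  have hprod := prod_GP p h2 hQ hQh hh (Nat.even_iff.2 (by omega)) (m := 2 * k) (by omega) hl0 hw hwo hζ
  have hneg : (γ : F) ^ h = -1 := by
    have h3 : IsPrimitiveRoot ((γ : F) ^ h) 2 := hgF.pow (by omega) (by ring)
    exact h3.eq_neg_one_of_two_right
  have hodd : ∀ x : F, (dickson 1 (1 : F) l).eval (-x) = -(dickson 1 (1 : F) l).eval x := by
    intro x
    rw [dick_neg, Odd.neg_one_pow (Nat.odd_iff.2 (by omega))]; ring
  have hfac : ∀ x : F, (dickson 1 (1 : F) l).eval x = x * (GP F (2 * k)).eval (x ^ 2) := by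
    intro x
    rw [(GP_eval_aux x (2 * k)).1, show 2 * (2 * k) + 1 = l by omega]
  have h0 : (dickson 1 (1 : F) l).eval 0 = 0 := by rw [hfac, zero_mul]
  have hset : (Finset.univ.erase (0 : F)) = (Finset.range (2 * h)).image (fun i => (γ : F) ^ i) := by
    symm
    apply Finset.eq_of_subset_of_card_le
    · intro x hx
      obtain ⟨i, _, rfl⟩ := Finset.mem_image.1 hx
      exact Finset.mem_erase.2 ⟨pow_ne_zero _ γ.ne_zero, Finset.mem_univ _⟩
    · rw [Finset.card_image_of_injOn hgF.injOn_pow, Finset.card_range,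
        Finset.card_erase_of_mem (Finset.mem_univ _), Finset.card_univ, hQh]
      omega
  set ε : ℕ → ℤ := fun i => quadraticChar F ((dickson 1 (1 : F) l).eval ((γ : F) ^ i)) with hε
  have hS : SS F l = 2 * ∑ i ∈ Finset.range h, ε i := by
    rw [SS, ← Finset.add_sum_erase _ _ (Finset.mem_univ (0 : F)), h0, hset,
      Finset.sum_image hgF.injOn_pow, two_mul h, Finset.sum_range_add, two_mul]
    rw [MulChar.map_zero, zero_add]
    congr 1
    refine Finset.sum_congr rfl (fun i _ => ?_)
    rw [pow_add, hneg, neg_one_mul, hodd, ← neg_one_mul, map_mul, chi_neg_one h8, one_mul]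
  have hG0 : ∀ i ∈ Finset.range h, (GP F (2 * k)).eval (((γ : F) ^ 2) ^ i) ≠ 0 := by
    rw [← Finset.prod_ne_zero_iff, hprod]
    exact pow_ne_zero _ (neg_ne_zero.2 h2)
  have hεv : ∀ i ∈ Finset.range h, ε i = 1 ∨ ε i = -1 := by
    intro i hi
    apply quadraticChar_dichotomy
    rw [hfac]
    refine mul_ne_zero (pow_ne_zero _ γ.ne_zero) ?_
    have := hG0 i hi
    rwa [← pow_mul, mul_comm, pow_mul] at this
  have hεp : ∏ i ∈ Finset.range h, ε i = 1 := by
    have h3 : ∀ i ∈ Finset.range h, ε i =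
        quadraticChar F ((γ : F) ^ i) * quadraticChar F ((GP F (2 * k)).eval (((γ : F) ^ 2) ^ i)) := by
      intro i _
      rw [hε]
      simp only
      rw [hfac, map_mul, ← pow_mul, ← pow_mul, mul_comm i 2]
    rw [Finset.prod_congr rfl h3, Finset.prod_mul_distrib, ← map_prod, ← map_prod, hprod,
      Finset.prod_pow_eq_pow_sum, map_pow, map_pow, pow_mul, quadraticChar_sq_one (neg_ne_zero.2 h2),
      one_pow, mul_one]
    have h4 := Finset.sum_range_id_mul_two h
    obtain ⟨j, hj⟩ : ∃ j, h = 4 * j := ⟨h / 4, by omega⟩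
    have h5 : ∑ i ∈ Finset.range h, i = 2 * (j * (h - 1)) := by
      have : h * (h - 1) = 4 * (j * (h - 1)) := by nth_rw 1 [hj]; ring
      omega
    rw [h5, pow_mul, quadraticChar_sq_one γ.ne_zero, one_pow]
  have h9 := (signs_mod (Finset.range h) ε hεv).1
  rw [hεp, Finset.card_range] at h9
  rw [hS]
  omega

end Plus
end Cheb

theorem statement12 (l k p : ℕ) (hl : l.Prime) (hlk : l = 4 * k + 1)
    (hk : k = 1 ∨ k.Prime)
    (hp : p.Prime) (hp4 : p % 4 = 1) (hne : p ≠ l)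
    (u : (ZMod l)ˣ) (hu : (u : ZMod l) = (p : ZMod l)) :
    (∃ n, 0 < n ∧ chebMaximal l (p ^ n)) ↔
      (∀ x : (ZMod l)ˣ, x ∈ Subgroup.zpowers u) := by
  classical
  have hpf : Fact p.Prime := ⟨hp⟩
  have hl1 := hl.two_le
  have hk0 : 0 < k := by omega
  have hpl : ¬ l ∣ p := by
    intro h
    exact hne ((Nat.prime_dvd_prime_iff_eq hl hp).1 h).symm
  have hpl' : ¬ p ∣ l := by
    intro h
    exact hne ((Nat.prime_dvd_prime_iff_eq hp hl).1 h)
  constructor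
  · rintro ⟨n, hn, hmax⟩
    let F := GaloisField p (2 * n)
    letI : Fintype F := Fintype.ofFinite F
    have hQ : Fintype.card F = (p ^ n) ^ 2 := by
      rw [← Nat.card_eq_fintype_card, GaloisField.card p (2 * n) (by omega), ← pow_mul, mul_comm]
    have h8 : Fintype.card F % 8 = 1 := by rw [hQ]; exact Cheb.card_mod8 hp4 rfl
    have hcount := hmax F hQ
    have hc2 := Cheb.count_eq h8 l
    have hS : Cheb.SS F l = (l - 1) * ((p ^ n : ℕ) : ℤ) := by
      rw [chebAffineCount] at hcount
      rw [hcount, hQ] at hc2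
      push_cast [Nat.cast_sub (show 1 ≤ l by omega)] at hc2 ⊢
      linarith
    have hQ1 : 1 < Fintype.card F := Fintype.one_lt_card
    by_cases h1 : l ∣ Fintype.card F - 1
    · exact Cheb.comb_conv hl hlk hk hpl hn (Cheb.conv_minus p hl hlk hp4 hn hQ h1 hS) u hu
    exfalso
    have hpn : 0 < p ^ n := pow_pos hp.pos n
    by_cases h2 : l ∣ Fintype.card F + 1
    · have h3 := Cheb.SS_plus p hl hlk hp4 (f := n * 2) (by rw [hQ, pow_mul]) h8 hpl' h2
      have h4 : (l : ℤ) - 1 = 4 * k := by rw [hlk]; push_cast; ring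
      rw [hS, h4] at h3
      have h5 : 2 ∣ k * p ^ n := by
        have h6 : 8 ∣ 4 * k * p ^ n := by exact_mod_cast h3
        rw [mul_assoc] at h6
        omega
      rcases (Nat.Prime.dvd_mul Nat.prime_two).1 h5 with h6 | h6
      · rcases hk with h7 | h7
        · omega
        · have h9 := (Nat.prime_dvd_prime_iff_eq Nat.prime_two h7).1 h6
          rw [hlk, ← h9] at hl
          revert hl; norm_num
      · have := Nat.prime_two.dvd_of_dvd_pow h6
        omega
    · have h3 := Cheb.SS_zero h8 (d := l) (by omega) ((Nat.Prime.coprime_iff_not_dvd hl).2 h2)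
        ((Nat.Prime.coprime_iff_not_dvd hl).2 h1)
      rw [hS] at h3
      rcases mul_eq_zero.1 h3 with h4 | h4
      · omega
      · have : p ^ n = 0 := by exact_mod_cast h4
        omega
  · intro hprim
    refine ⟨2 * k, by omega, ?_⟩
    intro F _ _ hQ
    have hchar : CharP F p := by
      refine charP_of_card_eq_prime_pow (f := 2 * k * 2) ?_
      rw [hQ, ← pow_mul]
    have h8 : Fintype.card F % 8 = 1 := by rw [hQ]; exact Cheb.card_mod8 hp4 rfl
    have hS := Cheb.dir_main (F := F) p hl hlk hp4 hk0 hpl hQ u hu hprim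
    have hc2 := Cheb.count_eq h8 l
    rw [hS, hQ] at hc2
    have h4 : (l : ℤ) - 1 = ((l - 1 : ℕ) : ℤ) := by omega
    rw [h4] at hc2
    rw [chebAffineCount]
    exact_mod_cast hc2
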